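/- arXiv:math/0703434 — 2 statements merged into one kernel-verified Lean document; each statement's English description precedes it below -/
import Mathlib

section
/- For every λ ≥ 0 and each a ∈ {p,w}, the kernel b^{a,λ} is square integrable: ∫_ℝ ∫_ℝ b^{a,λ}(x,y)² μ(dx) μ(dy) < ∞; consequently the integral operator h ↦ ∫_ℝ b^{a,λ}(·,y) h(y) μ(dy) is a Hilbert–Schmidt, hence compact, operator on L²(ℝ, μ). -/
open MeasureTheory Filter Topology Set
open scoped ENNReal NNReal BigOperators

noncomputable section

/-- The configuration `φ_{-1} = x, φ_0 = 0, (φ_1,…,φ_{n-2}) = w, φ_{n-1} = y, φ_n = 0`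
extended to `ℤ`. -/
def fExt (x y : ℝ) (n : ℕ) (w : Fin (n - 2) → ℝ) (i : ℤ) : ℝ :=
  if h1 : i ≤ -1 then x
  else if h2 : i = 0 then 0
  else if h : i ≤ (n : ℤ) - 2 then w ⟨i.toNat - 1, by omega⟩
  else if i = (n : ℤ) - 1 then y else 0

/-- the pinning density `f^p_{x,y}(n)` -/
def fpin (E : ℝ → ℝ) (x y : ℝ) (n : ℕ) : ℝ :=
  if n = 1 then (if y = 0 then E x else 0)
  else if y = 0 then 0
  else ∫ w : Fin (n - 2) → ℝ,
    ∏ m ∈ Finset.Icc (0 : ℤ) ((n : ℤ) - 1),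
      E (fExt x y n w (m + 1) + fExt x y n w (m - 1) - 2 * fExt x y n w m)

/-- the wetting density `f^w_{x,y}(n)` -/
def fwet (E : ℝ → ℝ) (x y : ℝ) (n : ℕ) : ℝ :=
  if 0 ≤ x ∧ 0 ≤ y then
    (if n = 1 then (if y = 0 then E x else 0)
    else if y = 0 then 0
    else ∫ w in {w : Fin (n - 2) → ℝ | ∀ i, 0 ≤ w i},
      ∏ m ∈ Finset.Icc (0 : ℤ) ((n : ℤ) - 1),
        E (fExt x y n w (m + 1) + fExt x y n w (m - 1) - 2 * fExt x y n w m))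
  else 0

/-- the reference measure `μ(dx) = δ_0(dx) + dx` on `ℝ` -/
def muK : Measure ℝ := Measure.dirac 0 + volume

open scoped Classical in
/-- the kernel density `b^{a,λ}(x,y) = e^{-λ} f^a_{x,0}(1) 1_{(y=0)} + ∑_{n≥2} e^{-λn} f^a_{x,y}(n) 1_{(y≠0)}` -/
def bker (f : ℝ → ℝ → ℕ → ℝ) (lam x y : ℝ) : ℝ :=
  (if y = 0 then Real.exp (-lam) * f x 0 1 else 0) +
    ∑' n : ℕ, (if 2 ≤ n ∧ y ≠ 0 then Real.exp (-lam * n) * f x y n else 0)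

/-- The weight, integrated over `m` free intermediate heights, of a chain which starts at heights
`a, b`, ends at heights `c, d`, and pays `e` at each of its `m + 2` second differences. -/
def chainKer (e : ℝ → ℝ≥0∞) : ℕ → ℝ → ℝ → ℝ → ℝ → ℝ≥0∞
  | 0, a, b, c, d => e (c + a - 2 * b) * e (d + b - 2 * c)
  | m + 1, a, b, c, d => ∫⁻ w, e (w + a - 2 * b) * chainKer e m b w c d

lemma measurable_chainKer_uncurry {e : ℝ → ℝ≥0∞} (he : Measurable e) (m : ℕ) :
    Measurable fun q : ℝ × ℝ × ℝ × ℝ => chainKer e m q.1 q.2.1 q.2.2.1 q.2.2.2 := by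
  induction m with
  | zero =>
    simp only [chainKer]
    fun_prop
  | succ m ih =>
    simp only [chainKer]
    apply Measurable.lintegral_prod_right
      (f := fun (q : ℝ × ℝ × ℝ × ℝ) (w : ℝ) =>
        e (w + q.1 - 2 * q.2.1) * chainKer e m q.2.1 w q.2.2.1 q.2.2.2)
    refine Measurable.mul (by fun_prop) ?_
    exact ih.comp (f := fun p : (ℝ × ℝ × ℝ × ℝ) × ℝ => (p.1.2.1, p.2, p.1.2.2.1, p.1.2.2.2))
      (by fun_prop)

lemma Measurable.chainKer {α : Type*} [MeasurableSpace α] {e : ℝ → ℝ≥0∞} (he : Measurable e)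
    (m : ℕ) {a b c d : α → ℝ} (ha : Measurable a) (hb : Measurable b) (hc : Measurable c)
    (hd : Measurable d) : Measurable fun t => chainKer e m (a t) (b t) (c t) (d t) :=
  (measurable_chainKer_uncurry he m).comp (ha.prodMk (hb.prodMk (hc.prodMk hd)))

lemma lintegral_step {e : ℝ → ℝ≥0∞} (hmass : ∫⁻ x, e x = 1) (a b : ℝ) :
    ∫⁻ w, e (w + a - 2 * b) = 1 := by
  simp_rw [add_sub_assoc]
  rw [lintegral_add_right_eq_self (fun w => e w), hmass]

lemma chainKer_le {e : ℝ → ℝ≥0∞} (he : Measurable e) (hmass : ∫⁻ x, e x = 1) {M : ℝ≥0∞}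
    (hM : ∀ x, e x ≤ M) (m : ℕ) (a b c d : ℝ) : chainKer e m a b c d ≤ M ^ 2 := by
  induction m generalizing a b with
  | zero =>
    rw [chainKer, sq]
    exact mul_le_mul' (hM _) (hM _)
  | succ m ih =>
    rw [chainKer]
    calc ∫⁻ w, e (w + a - 2 * b) * chainKer e m b w c d
        ≤ ∫⁻ w, e (w + a - 2 * b) * M ^ 2 := by
          gcongr with w
          exact ih _ _
      _ = M ^ 2 := by
          rw [lintegral_mul_const _ (by fun_prop), lintegral_step hmass, one_mul]

/-- Adding an affine function to the heights does not change the second differences. -/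
lemma chainKer_add_affine (e : ℝ → ℝ≥0∞) (m : ℕ) (a b c d u v : ℝ) :
    chainKer e m (a + u) (b + u + v) (c + u + (m + 2) * v) (d + u + (m + 3) * v)
      = chainKer e m a b c d := by
  induction m generalizing a b u with
  | zero =>
    simp only [chainKer]
    congr 2 <;> (push_cast; ring)
  | succ m ih =>
    simp only [chainKer]
    rw [← lintegral_add_right_eq_self _ (u + 2 * v)]
    refine lintegral_congr fun w => ?_
    rw [← ih b w (u + v)]
    congr 2 <;> (push_cast; ring)

lemma lintegral_chainKer {e : ℝ → ℝ≥0∞} (he : Measurable e) (hmass : ∫⁻ x, e x = 1) (m : ℕ)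
    (a b : ℝ) : ∫⁻ z : ℝ × ℝ, chainKer e m a b z.1 z.2 = 1 := by
  induction m generalizing a b with
  | zero =>
    rw [Measure.volume_eq_prod, lintegral_prod _ (by
      exact (Measurable.chainKer he 0 (by fun_prop) (by fun_prop) (by fun_prop)
        (by fun_prop)).aemeasurable)]
    simp only [chainKer]
    rw [← lintegral_step hmass a b]
    refine lintegral_congr fun w => ?_
    rw [lintegral_const_mul _ (by fun_prop), lintegral_step hmass, mul_one]
  | succ m ih =>
    simp only [chainKer]
    rw [lintegral_lintegral_swap]
    · rw [← lintegral_step hmass a b]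
      refine lintegral_congr fun w => ?_
      rw [lintegral_const_mul _ (Measurable.chainKer he m measurable_const measurable_const
        measurable_fst measurable_snd), ih, mul_one]
    · refine (Measurable.mul (by fun_prop) ?_).aemeasurable
      exact Measurable.chainKer he m (by fun_prop) (by fun_prop) (by fun_prop) (by fun_prop)

lemma lintegral_comp_mul_left_real (f : ℝ → ℝ≥0∞) {β : ℝ} (hβ : β ≠ 0) :
    ∫⁻ x, f (β * x) = ENNReal.ofReal |β⁻¹| * ∫⁻ x, f x := by
  have hm := Real.map_volume_mul_left hβ
  rw [← smul_eq_mul, ← lintegral_smul_measure, ← hm]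
  exact (lintegral_map_equiv f (Homeomorph.mulLeft₀ β hβ).toMeasurableEquiv).symm

lemma lintegral_chainKer_slope {e : ℝ → ℝ≥0∞} (he : Measurable e) (hmass : ∫⁻ x, e x = 1) (m : ℕ)
    (α : ℝ) {β : ℝ} (hβ : β ≠ 0) :
    ∫⁻ x : ℝ, ∫⁻ y : ℝ, chainKer e m 0 0 (y + α * x) (β * x) = ENNReal.ofReal |β⁻¹| := by
  have h1 : ∀ x : ℝ, ∫⁻ y : ℝ, chainKer e m 0 0 (y + α * x) (β * x)
      = ∫⁻ y : ℝ, chainKer e m 0 0 y (β * x) := fun x =>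
    lintegral_add_right_eq_self (fun y => chainKer e m 0 0 y (β * x)) _
  simp_rw [h1]
  rw [lintegral_comp_mul_left_real (fun x => ∫⁻ y : ℝ, chainKer e m 0 0 y x) hβ,
    lintegral_lintegral_swap, ← lintegral_prod (fun z : ℝ × ℝ => chainKer e m 0 0 z.1 z.2),
    ← Measure.volume_eq_prod, lintegral_chainKer he hmass, mul_one]
  · exact (Measurable.chainKer he m (by fun_prop) (by fun_prop) (by fun_prop)
      (by fun_prop)).aemeasurable
  · exact (Measurable.chainKer he m (by fun_prop) (by fun_prop) (by fun_prop)
      (by fun_prop)).aemeasurable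

lemma lintegral_chainKer_bridge {e : ℝ → ℝ≥0∞} (he : Measurable e) (hmass : ∫⁻ x, e x = 1)
    (m : ℕ) :
    ∫⁻ x : ℝ, ∫⁻ y : ℝ, chainKer e m x 0 y 0 = ENNReal.ofReal ((m : ℝ) + 2)⁻¹ := by
  have h : ∀ x y : ℝ, chainKer e m x 0 y 0
      = chainKer e m 0 0 (y + ((m : ℝ) + 1) * x) (((m : ℝ) + 2) * x) := fun x y => by
    rw [← chainKer_add_affine e m x 0 y 0 (-x) x]
    congr 1 <;> ring
  simp_rw [h]
  rw [lintegral_chainKer_slope he hmass _ _ (by positivity), abs_of_nonneg (by positivity)]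

lemma lintegral_chainKer_zero_le {e : ℝ → ℝ≥0∞} (he : Measurable e) (hmass : ∫⁻ x, e x = 1)
    {M : ℝ≥0∞} (hM : ∀ x, e x ≤ M) (m : ℕ) :
    ∫⁻ y : ℝ, chainKer e (m + 1) 0 0 y 0 ≤ M * ENNReal.ofReal ((m : ℝ) + 3)⁻¹ := by
  have h : ∀ w y : ℝ, chainKer e m 0 w y 0
      = chainKer e m 0 0 (y + (-((m : ℝ) + 2)) * w) (-((m : ℝ) + 3) * w) := fun w y => by
    rw [← chainKer_add_affine e m 0 w y 0 0 (-w)]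
    congr 1 <;> ring
  have hmeas : Measurable (Function.uncurry fun w y : ℝ => chainKer e m 0 w y 0) :=
    Measurable.chainKer he m (by fun_prop) (by fun_prop) (by fun_prop) (by fun_prop)
  calc ∫⁻ y : ℝ, chainKer e (m + 1) 0 0 y 0
      ≤ ∫⁻ y : ℝ, ∫⁻ w : ℝ, M * chainKer e m 0 w y 0 := by
        simp only [chainKer]
        gcongr
        exact hM _
    _ = M * ∫⁻ w : ℝ, ∫⁻ y : ℝ, chainKer e m 0 w y 0 := by
        rw [lintegral_lintegral_swap (hmeas.comp measurable_swap |>.const_mul M).aemeasurable]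
        refine Eq.trans (lintegral_congr fun w => ?_)
          (lintegral_const_mul _ hmeas.lintegral_prod_right')
        exact lintegral_const_mul _ (hmeas.comp measurable_prodMk_left)
    _ = M * ENNReal.ofReal ((m : ℝ) + 3)⁻¹ := by
        simp_rw [h]
        rw [lintegral_chainKer_slope he hmass _ _ (neg_ne_zero.2 (by positivity)), inv_neg,
          abs_neg, abs_of_nonneg (by positivity)]

lemma chainKer_le_liminf {e : ℝ → ℝ≥0∞} (he : Continuous e) (hfin : ∀ x, e x ≠ ⊤) (m : ℕ)
    (a b : ℝ) {c d : ℝ} {cs ds : ℕ → ℝ} (hc : Tendsto cs atTop (𝓝 c))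
    (hd : Tendsto ds atTop (𝓝 d)) :
    chainKer e m a b c d ≤ liminf (fun j => chainKer e m a b (cs j) (ds j)) atTop := by
  induction m generalizing a b with
  | zero =>
    simp only [chainKer]
    refine (Tendsto.liminf_eq (ENNReal.Tendsto.mul ?_ (Or.inr (hfin _)) ?_ (Or.inr (hfin _)))).ge
    · exact (he.tendsto _).comp ((hc.add_const a).sub_const _)
    · exact (he.tendsto _).comp ((hd.add_const b).sub (hc.const_mul 2))
  | succ m ih =>
    simp only [chainKer]
    refine le_trans ?_ (lintegral_liminf_le fun j => ?_)
    · refine lintegral_mono fun w => ?_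
      rw [ENNReal.liminf_const_mul_of_ne_top (hfin _)]
      gcongr
      exact ih _ _
    · refine Measurable.mul (by fun_prop) ?_
      exact Measurable.chainKer he.measurable m (by fun_prop) (by fun_prop) (by fun_prop)
        (by fun_prop)

/-- The heights `a, b, w_0, …, w_{m-1}, c, d` of a chain, listed from index `0`. -/
def chainSeq {m : ℕ} (a b : ℝ) (w : Fin m → ℝ) (c d : ℝ) (i : ℕ) : ℝ :=
  if h0 : i = 0 then a
  else if h1 : i = 1 then b
  else if h : i < m + 2 then w ⟨i - 2, by omega⟩
  else if i = m + 2 then c else d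

lemma chainSeq_cons_succ {m : ℕ} (a b w₀ : ℝ) (w : Fin m → ℝ) (c d : ℝ) (i : ℕ) :
    chainSeq a b (Fin.cons w₀ w : Fin (m + 1) → ℝ) c d (i + 1) = chainSeq b w₀ w c d i := by
  unfold chainSeq
  rcases i with _ | _ | i
  · simp
  · simp
  · by_cases hi : i < m
    · simp [hi]
      rw [show (⟨i + 1, by omega⟩ : Fin (m + 1)) = Fin.succ ⟨i, hi⟩ from rfl, Fin.cons_succ]
    · simp [hi]

@[fun_prop]
lemma measurable_chainSeq {m : ℕ} (a b c d : ℝ) (i : ℕ) :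
    Measurable fun w : Fin m → ℝ => chainSeq a b w c d i := by
  unfold chainSeq
  split_ifs <;> fun_prop

lemma lintegral_prod_chainSeq {e : ℝ → ℝ≥0∞} (he : Measurable e) (m : ℕ) (a b c d : ℝ) :
    ∫⁻ w : Fin m → ℝ, ∏ i ∈ Finset.range (m + 2),
        e (chainSeq a b w c d (i + 2) + chainSeq a b w c d i - 2 * chainSeq a b w c d (i + 1))
      = chainKer e m a b c d := by
  induction m generalizing a b with
  | zero =>
    rw [lintegral_unique]
    simp [Finset.prod_range_succ, chainSeq, chainKer, volume_pi]
  | succ m ih =>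
    have hmp := (volume_preserving_piFinSuccAbove (fun _ : Fin (m + 1) => ℝ) 0).symm
    rw [← hmp.lintegral_comp_emb (MeasurableEquiv.measurableEmbedding _), Measure.volume_eq_prod,
      lintegral_prod]
    · simp only [chainKer]
      refine lintegral_congr fun w₀ => ?_
      rw [← ih, ← lintegral_const_mul _ (by fun_prop)]
      refine lintegral_congr fun w => ?_
      rw [Finset.prod_range_succ']
      have hcons : (MeasurableEquiv.piFinSuccAbove (fun _ : Fin (m + 1) => ℝ) 0).symm (w₀, w)
          = (Fin.cons w₀ w : Fin (m + 1) → ℝ) := by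
        simp [MeasurableEquiv.piFinSuccAbove_symm_apply, Fin.insertNthEquiv]
      rw [hcons, mul_comm]
      congr 1
      refine Finset.prod_congr rfl fun i _ => ?_
      rw [chainSeq_cons_succ, chainSeq_cons_succ, chainSeq_cons_succ]
    · exact Measurable.aemeasurable (by fun_prop)

lemma fExt_eq_chainSeq (x y : ℝ) (m : ℕ) (w : Fin m → ℝ) (k : ℕ) :
    fExt x y (m + 2) w ((k : ℤ) - 1) = chainSeq x 0 w y 0 k := by
  unfold fExt chainSeq
  rcases k with _ | _ | k
  · simp
  · simp
  · have h1 : ¬ (((k + 2 : ℕ) : ℤ) - 1 ≤ -1) := by omega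
    have h2 : ((k + 2 : ℕ) : ℤ) - 1 ≠ 0 := by omega
    rw [dif_neg h1, dif_neg h2]
    by_cases hk : k < m
    · rw [dif_pos (by push_cast; omega), dif_neg (by omega), dif_neg (by omega), dif_pos (by omega)]
      congr 2
      omega
    · rw [dif_neg (by push_cast; omega), dif_neg (by omega), dif_neg (by omega), dif_neg (by omega)]
      refine if_congr ?_ rfl rfl
      push_cast
      omega

lemma prod_fExt_eq (E : ℝ → ℝ) (x y : ℝ) (m : ℕ) (w : Fin m → ℝ) :
    ∏ k ∈ Finset.Icc (0 : ℤ) (((m + 2 : ℕ) : ℤ) - 1),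
      E (fExt x y (m + 2) w (k + 1) + fExt x y (m + 2) w (k - 1) - 2 * fExt x y (m + 2) w k)
    = ∏ i ∈ Finset.range (m + 2),
      E (chainSeq x 0 w y 0 (i + 2) + chainSeq x 0 w y 0 i - 2 * chainSeq x 0 w y 0 (i + 1)) := by
  symm
  refine Finset.prod_nbij' (fun i => (i : ℤ)) Int.toNat ?_ ?_ ?_ ?_ ?_
  · intro i hi
    simp only [Finset.mem_range, Finset.mem_Icc] at *
    omega
  · intro i hi
    simp only [Finset.mem_range, Finset.mem_Icc] at *
    omega
  · intro i hi
    simp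
  · intro i hi
    simp only [Finset.mem_Icc] at hi
    omega
  · intro i hi
    simp only [← fExt_eq_chainSeq]
    congr 3 <;> (try congr 1) <;> (push_cast; ring_nf)

lemma ofReal_integral_prod_fExt_le {E : ℝ → ℝ} (hE : ∀ x, 0 ≤ E x) (hm : Measurable E) (x y : ℝ)
    (m : ℕ) (S : Set (Fin m → ℝ)) :
    ENNReal.ofReal (∫ w in S, ∏ k ∈ Finset.Icc (0 : ℤ) (((m + 2 : ℕ) : ℤ) - 1),
      E (fExt x y (m + 2) w (k + 1) + fExt x y (m + 2) w (k - 1) - 2 * fExt x y (m + 2) w k))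
    ≤ chainKer (fun t => ENNReal.ofReal (E t)) m x 0 y 0 := by
  rw [← lintegral_prod_chainSeq (by fun_prop)]
  simp_rw [prod_fExt_eq]
  refine (Real.ofReal_le_enorm _).trans ((enorm_integral_le_lintegral_enorm _).trans ?_)
  refine (setLIntegral_le_lintegral _ _).trans (lintegral_mono fun w => ?_)
  rw [Real.enorm_of_nonneg (Finset.prod_nonneg fun _ _ => hE _),
    ENNReal.ofReal_prod_of_nonneg fun _ _ => hE _]

lemma ofReal_fpin_le {E : ℝ → ℝ} (hE : ∀ x, 0 ≤ E x) (hm : Measurable E) (x : ℝ) {y : ℝ}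
    (hy : y ≠ 0) (m : ℕ) :
    ENNReal.ofReal (fpin E x y (m + 2)) ≤ chainKer (fun t => ENNReal.ofReal (E t)) m x 0 y 0 := by
  rw [fpin, if_neg (by omega), if_neg hy, ← setIntegral_univ]
  exact ofReal_integral_prod_fExt_le hE hm x y m univ

lemma ofReal_fwet_le {E : ℝ → ℝ} (hE : ∀ x, 0 ≤ E x) (hm : Measurable E) (x : ℝ) {y : ℝ}
    (hy : y ≠ 0) (m : ℕ) :
    ENNReal.ofReal (fwet E x y (m + 2)) ≤ chainKer (fun t => ENNReal.ofReal (E t)) m x 0 y 0 := by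
  rw [fwet]
  split_ifs with h h1
  · omega
  · exact ofReal_integral_prod_fExt_le hE hm x y m _
  · simp

lemma lintegral_comp_smul_addHaar {V : Type*} [NormedAddCommGroup V] [NormedSpace ℝ V]
    [MeasurableSpace V] [BorelSpace V] [FiniteDimensional ℝ V] (μ : Measure V) [μ.IsAddHaarMeasure]
    (f : V → ℝ≥0∞) {r : ℝ} (hr : r ≠ 0) :
    ∫⁻ x, f (r • x) ∂μ = ENNReal.ofReal |(r ^ Module.finrank ℝ V)⁻¹| * ∫⁻ x, f x ∂μ := by
  have hm := Measure.map_addHaar_smul μ hr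
  rw [← smul_eq_mul, ← lintegral_smul_measure, ← hm]
  exact (lintegral_map_equiv f (Homeomorph.smulOfNeZero r hr).toMeasurableEquiv).symm

/-- The pairing of a final state with a frequency, in height and increment coordinates. -/
def shearPairing : (ℝ × ℝ) →ₗ[ℝ] (ℝ × ℝ) →ₗ[ℝ] ℝ :=
  LinearMap.mk₂ ℝ (fun z w => z.1 * w.1 + (z.2 - z.1) * w.2)
    (by intros; simp; ring) (by intros; simp; ring) (by intros; simp; ring)
    (by intros; simp; ring)

lemma shearPairing_apply (z w : ℝ × ℝ) :
    shearPairing z w = z.1 * w.1 + (z.2 - z.1) * w.2 := rfl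

lemma continuous_shearPairing :
    Continuous fun p : (ℝ × ℝ) × (ℝ × ℝ) => shearPairing p.1 p.2 := by
  simp only [shearPairing_apply]
  fun_prop

lemma integral_fourierChar_mul_gaussian (v : ℝ) :
    ∫ x : ℝ, (Real.fourierChar (-(v * x)) : ℂ) * Complex.exp (-Real.pi * x ^ 2)
      = Complex.exp (-Real.pi * v ^ 2) := by
  have h := congrFun (fourier_gaussian_pi (b := 1) (by simp)) v
  simp only [Real.fourier_real_eq, mul_one, Complex.one_cpow, div_one, one_mul,
    Circle.smul_def, smul_eq_mul] at h
  rw [← h]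
  simp_rw [mul_comm v]

/-- The standard Gaussian weight in height and increment coordinates. -/
def shearGauss (z : ℝ × ℝ) : ℝ :=
  Real.exp (-Real.pi * z.1 ^ 2) * Real.exp (-Real.pi * (z.2 - z.1) ^ 2)

lemma shearGauss_nonneg (z : ℝ × ℝ) : 0 ≤ shearGauss z := by
  unfold shearGauss
  positivity

lemma shearGauss_le_one (z : ℝ × ℝ) : shearGauss z ≤ 1 := by
  unfold shearGauss
  refine mul_le_one₀ ?_ (Real.exp_nonneg _) ?_ <;>
  · rw [Real.exp_le_one_iff, neg_mul, neg_nonpos]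
    have := Real.pi_pos
    positivity

lemma continuous_shearGauss : Continuous shearGauss := by
  unfold shearGauss
  fun_prop

lemma integrable_gauss_pi : Integrable fun x : ℝ => Real.exp (-Real.pi * x ^ 2) :=
  integrable_exp_neg_mul_sq Real.pi_pos

lemma lintegral_gauss_pi : ∫⁻ x : ℝ, ENNReal.ofReal (Real.exp (-Real.pi * x ^ 2)) = 1 := by
  rw [← ofReal_integral_eq_lintegral_ofReal integrable_gauss_pi
    (ae_of_all _ fun x => Real.exp_nonneg _), integral_gaussian, div_self Real.pi_ne_zero,
    Real.sqrt_one, ENNReal.ofReal_one]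

lemma lintegral_shearGauss : ∫⁻ z, ENNReal.ofReal (shearGauss z) = 1 := by
  rw [Measure.volume_eq_prod, lintegral_prod _
    (continuous_shearGauss.measurable.ennreal_ofReal).aemeasurable]
  rw [← lintegral_gauss_pi]
  refine lintegral_congr fun x => ?_
  simp only [shearGauss, ENNReal.ofReal_mul (Real.exp_nonneg _)]
  rw [lintegral_const_mul _ (by fun_prop),
    lintegral_sub_right_eq_self (fun y => ENNReal.ofReal (Real.exp (-Real.pi * y ^ 2))),
    lintegral_gauss_pi, mul_one]

/-- The Gaussian weight on frequencies. -/
def freqGauss (w : ℝ × ℝ) : ℂ :=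
  Complex.exp (-Real.pi * w.1 ^ 2) * Complex.exp (-Real.pi * w.2 ^ 2)

lemma integrable_cexp_gauss_pi : Integrable fun x : ℝ => Complex.exp (-Real.pi * x ^ 2) :=
  integrable_cexp_neg_mul_sq (by simpa using Real.pi_pos)

lemma integrable_freqGauss : Integrable freqGauss :=
  integrable_cexp_gauss_pi.mul_prod integrable_cexp_gauss_pi

lemma enorm_freqGauss_le_one (w : ℝ × ℝ) : ‖freqGauss w‖ₑ ≤ 1 := by
  have h : freqGauss w = ((shearGauss (w.1, w.2 + w.1) : ℝ) : ℂ) := by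
    simp [freqGauss, shearGauss]
  rw [h, ← ofReal_norm, Complex.norm_real, Real.norm_of_nonneg (shearGauss_nonneg _),
    ENNReal.ofReal_le_one]
  exact shearGauss_le_one _

lemma fourierIntegral_freqGauss (z : ℝ × ℝ) :
    VectorFourier.fourierIntegral Real.fourierChar volume shearPairing.flip freqGauss z
      = ((shearGauss z : ℝ) : ℂ) := by
  have h : ∀ w : ℝ × ℝ, Real.fourierChar (-(shearPairing z w)) • freqGauss w
      = ((Real.fourierChar (-(z.1 * w.1)) : ℂ) * Complex.exp (-Real.pi * w.1 ^ 2))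
        * ((Real.fourierChar (-((z.2 - z.1) * w.2)) : ℂ) * Complex.exp (-Real.pi * w.2 ^ 2)) := by
    intro w
    rw [shearPairing_apply, neg_add, AddChar.map_add_eq_mul, Circle.smul_def, Circle.coe_mul,
      freqGauss, smul_eq_mul]
    ring
  simp only [VectorFourier.fourierIntegral, LinearMap.flip_apply, h]
  rw [Measure.volume_eq_prod,
    integral_prod_mul (fun x : ℝ => (Real.fourierChar (-(z.1 * x)) : ℂ)
      * Complex.exp (-Real.pi * x ^ 2)) (fun x : ℝ => (Real.fourierChar (-((z.2 - z.1) * x)) : ℂ)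
      * Complex.exp (-Real.pi * x ^ 2)),
    integral_fourierChar_mul_gaussian, integral_fourierChar_mul_gaussian]
  simp [shearGauss]

/-- The Fourier transform of an extended nonnegative density on the plane. -/
def planeFT (p : ℝ × ℝ → ℝ≥0∞) (w : ℝ × ℝ) : ℂ :=
  ∫ z, (Real.fourierChar (-(shearPairing z w)) : ℂ) * ((p z).toReal : ℂ)

lemma enorm_planeFT_affine (p : ℝ × ℝ → ℝ≥0∞) (z₀ w : ℝ × ℝ) {ε : ℝ} (hε : 0 < ε) :
    ‖planeFT (fun z => p (z₀ + ε • z)) w‖ₑ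
      = ENNReal.ofReal (ε ^ 2)⁻¹ * ‖planeFT p (ε⁻¹ • w)‖ₑ := by
  have hphase : ∀ z : ℝ × ℝ, (Real.fourierChar (-(shearPairing z w)) : ℂ)
      = (Real.fourierChar (shearPairing z₀ (ε⁻¹ • w)) : ℂ)
        * (Real.fourierChar (-(shearPairing (z₀ + ε • z) (ε⁻¹ • w))) : ℂ) := by
    intro z
    rw [← Circle.coe_mul, ← AddChar.map_add_eq_mul]
    congr 2
    simp only [map_add, map_smul, LinearMap.add_apply, LinearMap.smul_apply, smul_eq_mul]
    field_simp
    ring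
  have h : planeFT (fun z => p (z₀ + ε • z)) w
      = (Real.fourierChar (shearPairing z₀ (ε⁻¹ • w)) : ℂ)
        * (((ε ^ 2)⁻¹ : ℝ) • planeFT p (ε⁻¹ • w)) := by
    unfold planeFT
    simp_rw [hphase, mul_assoc]
    rw [integral_const_mul]
    congr 1
    rw [Measure.integral_comp_smul volume (fun z => (Real.fourierChar (-(shearPairing (z₀ + z)
      (ε⁻¹ • w))) : ℂ) * ((p (z₀ + z)).toReal : ℂ)) ε,
      integral_add_left_eq_self (fun z => (Real.fourierChar (-(shearPairing z
      (ε⁻¹ • w))) : ℂ) * ((p z).toReal : ℂ)) z₀]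
    simp [abs_of_pos hε]
  rw [h, enorm_mul, enorm_smul, ← ofReal_norm, Circle.norm_coe, ENNReal.ofReal_one,
    one_mul, Real.enorm_of_nonneg (by positivity)]

lemma lintegral_mul_shearGauss_le {p : ℝ × ℝ → ℝ≥0∞} (hp : Measurable p) (hfin : ∀ z, p z ≠ ⊤)
    (hEint : ∫⁻ z, p z ≠ ⊤) :
    ∫⁻ z, p z * ENNReal.ofReal (shearGauss z) ≤ ∫⁻ w, ‖planeFT p w‖ₑ := by
  have hpi : Integrable fun z => (p z).toReal := integrable_toReal_of_lintegral_ne_top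
    hp.aemeasurable hEint
  have hswap := VectorFourier.integral_fourierIntegral_smul_eq_flip (μ := volume) (ν := volume)
    (f := fun z => ((p z).toReal : ℂ)) (L := shearPairing) Real.continuous_fourierChar
    continuous_shearPairing hpi.ofReal
    integrable_freqGauss
  have hFT : ∀ w, VectorFourier.fourierIntegral Real.fourierChar volume shearPairing
      (fun z => ((p z).toReal : ℂ)) w = planeFT p w := fun w => by
    simp [VectorFourier.fourierIntegral, planeFT, Circle.smul_def]
  have hprod : Integrable fun z => (p z).toReal * shearGauss z := by
    refine hpi.mul_bdd (c := 1) continuous_shearGauss.aestronglyMeasurable (ae_of_all _ fun z => ?_)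
    rw [Real.norm_of_nonneg (shearGauss_nonneg _)]
    exact shearGauss_le_one _
  have hnn : 0 ≤ ∫ z, (p z).toReal * shearGauss z :=
    integral_nonneg fun z => mul_nonneg ENNReal.toReal_nonneg (shearGauss_nonneg _)
  calc ∫⁻ z, p z * ENNReal.ofReal (shearGauss z)
      = ∫⁻ z, ENNReal.ofReal ((p z).toReal * shearGauss z) := by
        refine lintegral_congr fun z => ?_
        rw [ENNReal.ofReal_mul ENNReal.toReal_nonneg, ENNReal.ofReal_toReal (hfin z)]
    _ = ‖∫ z, (p z).toReal * shearGauss z‖ₑ := by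
        rw [← ofReal_integral_eq_lintegral_ofReal hprod (ae_of_all _ fun z =>
          mul_nonneg ENNReal.toReal_nonneg (shearGauss_nonneg _)), Real.enorm_of_nonneg hnn]
    _ = ‖∫ w, planeFT p w * freqGauss w‖ₑ := by
        simp only [hFT, fourierIntegral_freqGauss, smul_eq_mul] at hswap
        rw [hswap]
        simp_rw [← Complex.ofReal_mul]
        rw [integral_complex_ofReal, ← ofReal_norm, ← ofReal_norm,
          Complex.norm_real]
    _ ≤ ∫⁻ w, ‖planeFT p w * freqGauss w‖ₑ := enorm_integral_le_lintegral_enorm _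
    _ ≤ ∫⁻ w, ‖planeFT p w‖ₑ := by
        refine lintegral_mono fun w => ?_
        rw [enorm_mul]
        exact mul_le_of_le_one_right' (enorm_freqGauss_le_one w)

/-- A sequentially lower semicontinuous density is bounded by the `L¹` norm of its Fourier
transform. -/
lemma le_lintegral_planeFT {p : ℝ × ℝ → ℝ≥0∞} (hp : Measurable p) (hfin : ∀ z, p z ≠ ⊤)
    (hEint : ∫⁻ z, p z ≠ ⊤) (z₀ : ℝ × ℝ)
    (hlsc : ∀ zs : ℕ → ℝ × ℝ, Tendsto zs atTop (𝓝 z₀) →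
      p z₀ ≤ liminf (fun j => p (zs j)) atTop) :
    p z₀ ≤ ∫⁻ w, ‖planeFT p w‖ₑ := by
  have hε : ∀ j : ℕ, 0 < 1 / ((j : ℝ) + 1) := fun j => by positivity
  have hG : Measurable fun z => ENNReal.ofReal (shearGauss z) :=
    continuous_shearGauss.measurable.ennreal_ofReal
  have hrank : Module.finrank ℝ (ℝ × ℝ) = 2 := by simp
  have hbound : ∀ j : ℕ, ∫⁻ z, p (z₀ + (1 / ((j : ℝ) + 1)) • z) * ENNReal.ofReal (shearGauss z)
      ≤ ∫⁻ w, ‖planeFT p w‖ₑ := fun j => by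
    set ε := 1 / ((j : ℝ) + 1) with hεdef
    have hεj : 0 < ε := hε j
    refine (lintegral_mul_shearGauss_le (p := fun z => p (z₀ + ε • z)) (by fun_prop)
      (fun z => hfin _) ?_).trans ?_
    · rw [lintegral_comp_smul_addHaar volume (fun z => p (z₀ + z)) hεj.ne',
        lintegral_add_left_eq_self (fun z => p z)]
      exact ENNReal.mul_ne_top ENNReal.ofReal_ne_top hEint
    · simp_rw [enorm_planeFT_affine p z₀ _ hεj]
      rw [lintegral_const_mul' _ _ ENNReal.ofReal_ne_top,
        lintegral_comp_smul_addHaar volume (fun w => ‖planeFT p w‖ₑ) (inv_ne_zero hεj.ne'),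
        ← mul_assoc, ← ENNReal.ofReal_mul (by positivity), hrank]
      have : (ε ^ 2)⁻¹ * |((ε⁻¹) ^ 2)⁻¹| = 1 := by
        rw [abs_of_pos (by positivity)]
        field_simp
      rw [this, ENNReal.ofReal_one, one_mul]
  calc p z₀ = ∫⁻ z, p z₀ * ENNReal.ofReal (shearGauss z) := by
        rw [lintegral_const_mul _ hG, lintegral_shearGauss, mul_one]
    _ ≤ ∫⁻ z, liminf (fun j : ℕ =>
          p (z₀ + (1 / ((j : ℝ) + 1)) • z) * ENNReal.ofReal (shearGauss z)) atTop := by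
        refine lintegral_mono fun z => ?_
        simp_rw [mul_comm _ (ENNReal.ofReal (shearGauss z))]
        rw [ENNReal.liminf_const_mul_of_ne_top ENNReal.ofReal_ne_top]
        gcongr
        refine hlsc _ ?_
        have h0 := (tendsto_one_div_add_atTop_nhds_zero_nat (𝕜 := ℝ)).smul_const z
        simpa using h0.const_add z₀
    _ ≤ liminf (fun j : ℕ => ∫⁻ z,
          p (z₀ + (1 / ((j : ℝ) + 1)) • z) * ENNReal.ofReal (shearGauss z)) atTop :=
        lintegral_liminf_le fun j => by fun_prop
    _ ≤ ∫⁻ w, ‖planeFT p w‖ₑ :=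
        liminf_le_of_le (by isBoundedDefault) fun b hb => by
          obtain ⟨j, hj⟩ := hb.exists
          exact hj.trans (hbound j)

/-- The Fourier transform of the step density. -/
def stepFT (E : ℝ → ℝ) (u : ℝ) : ℂ :=
  ∫ x, (Real.fourierChar (-(x * u)) : ℂ) * (E x : ℂ)

lemma integral_fourierChar_mul_step (E : ℝ → ℝ) (a b β r : ℝ) :
    ∫ w, (Real.fourierChar (-(w * β + r)) : ℂ) * (E (w + a - 2 * b) : ℂ)
      = stepFT E β * (Real.fourierChar (-((2 * b - a) * β + r)) : ℂ) := by
  rw [stepFT, ← integral_mul_const, ← integral_add_right_eq_self _ (2 * b - a)]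
  congr 1
  ext w
  rw [mul_right_comm, ← Circle.coe_mul, ← AddChar.map_add_eq_mul]
  congr 3
  · ring
  · ring_nf

lemma enorm_circle (z : Circle) : ‖(z : ℂ)‖ₑ = 1 := by
  rw [← ofReal_norm, Circle.norm_coe, ENNReal.ofReal_one]

section ChainFourier

variable {E : ℝ → ℝ}

lemma lintegral_ofReal_eq_one (hE : ∀ x, 0 ≤ E x) (hEint : Integrable E) (hmass : ∫ x, E x = 1) :
    ∫⁻ x, ENNReal.ofReal (E x) = 1 := by
  rw [← ofReal_integral_eq_lintegral_ofReal hEint (ae_of_all _ hE), hmass, ENNReal.ofReal_one]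

lemma chainKer_ne_top (hm : Measurable E) (hmass : ∫⁻ x, ENNReal.ofReal (E x) = 1) {M : ℝ}
    (hM : ∀ x, E x ≤ M) (m : ℕ) (a b c d : ℝ) :
    chainKer (fun t => ENNReal.ofReal (E t)) m a b c d ≠ ⊤ :=
  ne_top_of_le_ne_top (ENNReal.pow_ne_top ENNReal.ofReal_ne_top)
    (chainKer_le (by fun_prop) hmass (fun x => ENNReal.ofReal_le_ofReal (hM x)) m a b c d)

lemma planeFT_chainKer_zero (hE : ∀ x, 0 ≤ E x) (hm : Measurable E)
    (hmass : ∫⁻ x, ENNReal.ofReal (E x) = 1) (a b : ℝ) (w : ℝ × ℝ) :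
    planeFT (fun z => chainKer (fun t => ENNReal.ofReal (E t)) 0 a b z.1 z.2) w
      = ∫ x, ∫ y, (Real.fourierChar (-(y * w.2 + x * (w.1 - w.2))) : ℂ)
          * (E (y + b - 2 * x) : ℂ) * (E (x + a - 2 * b) : ℂ) := by
  have he : Measurable fun t => ENNReal.ofReal (E t) := by fun_prop
  have hEint := integrable_toReal_of_lintegral_ne_top (μ := (volume : Measure (ℝ × ℝ)))
    (Measurable.chainKer he 0 (measurable_const (a := a)) (measurable_const (a := b)) measurable_fst
      measurable_snd).aemeasurable (by rw [lintegral_chainKer he hmass]; simp)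
  rw [planeFT, Measure.volume_eq_prod, integral_prod]
  · refine integral_congr_ae (ae_of_all _ fun x => integral_congr_ae (ae_of_all _ fun y => ?_))
    simp only [chainKer, shearPairing_apply, ENNReal.toReal_mul, ENNReal.toReal_ofReal (hE _)]
    push_cast
    rw [show x * w.1 + (y - x) * w.2 = y * w.2 + x * (w.1 - w.2) by ring]
    ring
  · refine hEint.ofReal.bdd_mul (c := 1) ?_ (ae_of_all _ fun z => (Circle.norm_coe _).le)
    refine Continuous.aestronglyMeasurable ?_
    simp only [shearPairing_apply]
    fun_prop

lemma planeFT_chainKer_succ (hE : ∀ x, 0 ≤ E x) (hm : Measurable E)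
    (hmass : ∫⁻ x, ENNReal.ofReal (E x) = 1) {M : ℝ} (hM : ∀ x, E x ≤ M) (m : ℕ) (a b : ℝ)
    (w : ℝ × ℝ) :
    planeFT (fun z => chainKer (fun t => ENNReal.ofReal (E t)) (m + 1) a b z.1 z.2) w
      = ∫ x, planeFT (fun z => chainKer (fun t => ENNReal.ofReal (E t)) m b x z.1 z.2) w
          * (E (x + a - 2 * b) : ℂ) := by
  have he : Measurable fun t => ENNReal.ofReal (E t) := by fun_prop
  set K := chainKer (fun t => ENNReal.ofReal (E t)) with hK
  have hmeas : Measurable fun q : (ℝ × ℝ) × ℝ =>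
      ENNReal.ofReal (E (q.2 + a - 2 * b)) * K m b q.2 q.1.1 q.1.2 :=
    Measurable.mul (by fun_prop) (Measurable.chainKer he m (by fun_prop) (by fun_prop)
      (by fun_prop) (by fun_prop))
  have hEint : Integrable fun q : (ℝ × ℝ) × ℝ =>
      (ENNReal.ofReal (E (q.2 + a - 2 * b)) * K m b q.2 q.1.1 q.1.2).toReal := by
    refine integrable_toReal_of_lintegral_ne_top hmeas.aemeasurable ?_
    rw [Measure.volume_eq_prod, lintegral_prod _ hmeas.aemeasurable]
    have := lintegral_chainKer he hmass (m + 1) a b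
    simp only [chainKer] at this
    rw [this]
    simp
  have hstep : ∀ z : ℝ × ℝ, ((K (m + 1) a b z.1 z.2).toReal : ℂ)
      = ∫ x, ((ENNReal.ofReal (E (x + a - 2 * b)) * K m b x z.1 z.2).toReal : ℂ) := by
    intro z
    rw [integral_complex_ofReal, integral_toReal]
    · rfl
    · exact (hmeas.comp (measurable_prodMk_left (x := z))).aemeasurable
    · exact ae_of_all _ fun x => (ENNReal.mul_ne_top ENNReal.ofReal_ne_top
        (chainKer_ne_top hm hmass hM _ _ _ _ _)).lt_top
  unfold planeFT
  simp_rw [hstep, ← integral_const_mul]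
  rw [integral_integral_swap]
  · refine integral_congr_ae (ae_of_all _ fun x => ?_)
    dsimp only
    rw [← integral_mul_const]
    refine integral_congr_ae (ae_of_all _ fun z => ?_)
    simp only [ENNReal.toReal_mul, ENNReal.toReal_ofReal (hE _)]
    push_cast
    ring
  · refine hEint.ofReal.bdd_mul (c := 1) ?_ (ae_of_all _ fun z => (Circle.norm_coe _).le)
    refine Continuous.aestronglyMeasurable ?_
    simp only [shearPairing_apply]
    fun_prop

lemma planeFT_chainKer (hE : ∀ x, 0 ≤ E x) (hm : Measurable E)
    (hmass : ∫⁻ x, ENNReal.ofReal (E x) = 1) {M : ℝ} (hM : ∀ x, E x ≤ M) (m : ℕ) (a b : ℝ)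
    (w : ℝ × ℝ) :
    planeFT (fun z => chainKer (fun t => ENNReal.ofReal (E t)) m a b z.1 z.2) w
      = (∏ k ∈ Finset.range (m + 2), stepFT E (w.2 + k * w.1))
        * (Real.fourierChar (-(b * (w.2 + (m + 2) * w.1) - a * (w.2 + (m + 1) * w.1))) : ℂ) := by
  induction m generalizing a b with
  | zero =>
    rw [planeFT_chainKer_zero hE hm hmass]
    simp_rw [integral_mul_const, integral_fourierChar_mul_step, mul_assoc]
    rw [integral_const_mul]
    have h : ∀ x : ℝ, (2 * x - b) * w.2 + x * (w.1 - w.2) = x * (w.2 + w.1) + -(b * w.2) :=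
      fun x => by ring
    simp_rw [h, integral_fourierChar_mul_step]
    simp only [Finset.prod_range_succ, Finset.prod_range_zero, one_mul]
    rw [← mul_assoc]
    congr 3
    · simp
    · congr 1; simp
    · congr 1
      push_cast
      ring
  | succ m ih =>
    rw [planeFT_chainKer_succ hE hm hmass hM]
    simp_rw [ih, mul_assoc]
    rw [integral_const_mul, Finset.prod_range_succ _ (m + 2), mul_assoc]
    congr 1
    have h : ∀ x : ℝ, x * (w.2 + (m + 2) * w.1) - b * (w.2 + (m + 1) * w.1)
        = x * (w.2 + (m + 2) * w.1) + -(b * (w.2 + (m + 1) * w.1)) := fun x => by ring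
    simp_rw [h, integral_fourierChar_mul_step]
    congr 2
    · push_cast
      ring
    · congr 2
      push_cast
      ring

lemma chainKer_le_lintegral_prod_stepFT (hE : ∀ x, 0 ≤ E x) (hc : Continuous E)
    (hmass : ∫⁻ x, ENNReal.ofReal (E x) = 1) {M : ℝ} (hM : ∀ x, E x ≤ M) (m : ℕ)
    (a b c d : ℝ) :
    chainKer (fun t => ENNReal.ofReal (E t)) m a b c d
      ≤ ∫⁻ w : ℝ × ℝ, ∏ k ∈ Finset.range (m + 2), ‖stepFT E (w.2 + k * w.1)‖ₑ := by
  have he : Measurable fun t => ENNReal.ofReal (E t) := hc.measurable.ennreal_ofReal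
  refine (le_lintegral_planeFT
    (p := fun z => chainKer (fun t => ENNReal.ofReal (E t)) m a b z.1 z.2)
    (Measurable.chainKer he m measurable_const measurable_const measurable_fst measurable_snd)
    (fun z => chainKer_ne_top hc.measurable hmass hM _ _ _ _ _)
    (by rw [lintegral_chainKer he hmass]; simp) (c, d) ?_).trans_eq ?_
  · intro zs hzs
    exact chainKer_le_liminf (ENNReal.continuous_ofReal.comp hc) (fun x => ENNReal.ofReal_ne_top)
      m a b ((continuous_fst.tendsto _).comp hzs) ((continuous_snd.tendsto _).comp hzs)
  · refine lintegral_congr fun w => ?_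
    rw [planeFT_chainKer hE hc.measurable hmass hM, enorm_mul, enorm_circle, mul_one]
    simp [enorm_eq_nnnorm]

end ChainFourier

lemma stepFT_eq_fourierIntegral (E : ℝ → ℝ) :
    stepFT E = VectorFourier.fourierIntegral Real.fourierChar volume (LinearMap.mul ℝ ℝ)
      (fun x => (E x : ℂ)) := by
  ext u
  simp [stepFT, VectorFourier.fourierIntegral, Circle.smul_def]

lemma continuous_stepFT {E : ℝ → ℝ} (hEint : Integrable E) : Continuous (stepFT E) := by
  rw [stepFT_eq_fourierIntegral]
  exact VectorFourier.fourierIntegral_continuous Real.continuous_fourierChar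
    (by simpa using continuous_mul) hEint.ofReal

lemma stepFT_mul_stepFT_neg (E : ℝ → ℝ) (u : ℝ) :
    stepFT E u * stepFT E (-u) = ((‖stepFT E u‖ ^ 2 : ℝ) : ℂ) := by
  have h : stepFT E (-u) = (starRingEnd ℂ) (stepFT E u) := by
    unfold stepFT
    rw [← integral_conj]
    congr 1
    ext x
    rw [map_mul, Complex.conj_ofReal, ← Circle.coe_inv_eq_conj, ← AddChar.map_neg_eq_inv]
    congr 3
    ring
  rw [h, Complex.mul_conj, Complex.normSq_eq_norm_sq]

/-- The pairing whose Fourier transform of `E ⊗ E` is `|stepFT E|²`, dilated by `r`. -/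
def diffPairing (r : ℝ) : (ℝ × ℝ) →ₗ[ℝ] ℝ →ₗ[ℝ] ℝ :=
  LinearMap.mk₂ ℝ (fun z u => r * (z.1 - z.2) * u)
    (by intros; simp; ring) (by intros; simp; ring) (by intros; ring)
    (by intros; simp; ring)

lemma diffPairing_apply (r : ℝ) (z : ℝ × ℝ) (u : ℝ) :
    diffPairing r z u = r * (z.1 - z.2) * u := rfl

lemma lintegral_ofReal_gauss_scaled {r : ℝ} (hr : 0 < r) (x : ℝ) :
    ∫⁻ y : ℝ, ENNReal.ofReal (Real.exp (-Real.pi * (r * (x - y)) ^ 2)) = ENNReal.ofReal r⁻¹ := by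
  rw [lintegral_sub_left_eq_self (fun y => ENNReal.ofReal (Real.exp (-Real.pi * (r * y) ^ 2))),
    lintegral_comp_mul_left_real (fun y => ENNReal.ofReal (Real.exp (-Real.pi * y ^ 2))) hr.ne',
    lintegral_gauss_pi, mul_one, abs_of_pos (by positivity)]

lemma integral_sq_norm_stepFT_mul_gauss {E : ℝ → ℝ} (hEint : Integrable E) (r : ℝ) :
    ∫ u, ((‖stepFT E (r * u)‖ ^ 2 : ℝ) : ℂ) * Complex.exp (-Real.pi * u ^ 2)
      = ∫ z : ℝ × ℝ, ((E z.1 : ℂ) * (E z.2 : ℂ))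
        * ((Real.exp (-Real.pi * (r * (z.1 - z.2)) ^ 2) : ℝ) : ℂ) := by
  have hf : Integrable (fun z : ℝ × ℝ => (E z.1 : ℂ) * (E z.2 : ℂ)) :=
    hEint.ofReal.mul_prod hEint.ofReal
  have hswap := VectorFourier.integral_fourierIntegral_smul_eq_flip (μ := volume) (ν := volume)
    (f := fun z : ℝ × ℝ => (E z.1 : ℂ) * (E z.2 : ℂ)) (L := diffPairing r)
    Real.continuous_fourierChar (by simp only [diffPairing_apply]; fun_prop) hf
    integrable_cexp_gauss_pi
  have hleft : ∀ u, VectorFourier.fourierIntegral Real.fourierChar volume (diffPairing r)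
      (fun z : ℝ × ℝ => (E z.1 : ℂ) * (E z.2 : ℂ)) u = ((‖stepFT E (r * u)‖ ^ 2 : ℝ) : ℂ) := by
    intro u
    rw [← stepFT_mul_stepFT_neg]
    unfold stepFT
    rw [← integral_prod_mul, ← Measure.volume_eq_prod, VectorFourier.fourierIntegral]
    congr 1
    ext z
    rw [diffPairing_apply, Circle.smul_def, smul_eq_mul,
      show -(r * (z.1 - z.2) * u) = -(z.1 * (r * u)) + -(z.2 * (-(r * u))) by ring,
      AddChar.map_add_eq_mul, Circle.coe_mul]
    ring
  have hright : ∀ z : ℝ × ℝ, VectorFourier.fourierIntegral Real.fourierChar volume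
      (diffPairing r).flip (fun u : ℝ => Complex.exp (-Real.pi * u ^ 2)) z
      = ((Real.exp (-Real.pi * (r * (z.1 - z.2)) ^ 2) : ℝ) : ℂ) := by
    intro z
    simp only [VectorFourier.fourierIntegral, LinearMap.flip_apply, diffPairing_apply,
      Circle.smul_def, smul_eq_mul]
    rw [integral_fourierChar_mul_gaussian]
    simp
  simpa only [hleft, hright, smul_eq_mul] using hswap

lemma lintegral_enorm_stepFT_sq_mul_gauss_le {E : ℝ → ℝ} (hE : ∀ x, 0 ≤ E x) (hc : Continuous E)
    (hEint : Integrable E) (hmass : ∫⁻ x, ENNReal.ofReal (E x) = 1) {M : ℝ} (hM : ∀ x, E x ≤ M)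
    {r : ℝ} (hr : 0 < r) :
    ∫⁻ u, ‖stepFT E u‖ₑ ^ 2 * ENNReal.ofReal (Real.exp (-Real.pi * (r⁻¹ * u) ^ 2))
      ≤ ENNReal.ofReal M := by
  have hM0 : 0 ≤ M := (hE 0).trans (hM 0)
  have hψ := continuous_stepFT hEint
  have hgauss : ∀ u : ℝ, Complex.exp (-Real.pi * u ^ 2)
      = ((Real.exp (-Real.pi * u ^ 2) : ℝ) : ℂ) := fun u => by simp
  have hle1 : ∀ u, ‖stepFT E u‖ ≤ ∫ x, ‖E x‖ := fun u => by
    refine (norm_integral_le_integral_norm _).trans_eq ?_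
    simp_rw [norm_mul, Circle.norm_coe, one_mul, Complex.norm_real]
  have hint1 : Integrable fun u => ‖stepFT E (r * u)‖ ^ 2 * Real.exp (-Real.pi * u ^ 2) := by
    refine integrable_gauss_pi.bdd_mul (c := (∫ x, ‖E x‖) ^ 2)
      (Continuous.aestronglyMeasurable (by fun_prop)) (ae_of_all _ fun u => ?_)
    rw [Real.norm_of_nonneg (by positivity)]
    gcongr
    exact hle1 _
  have hscaled : ∫⁻ u, ‖stepFT E (r * u)‖ₑ ^ 2 * ENNReal.ofReal (Real.exp (-Real.pi * u ^ 2))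
      ≤ ENNReal.ofReal M * ENNReal.ofReal r⁻¹ := by
    calc ∫⁻ u, ‖stepFT E (r * u)‖ₑ ^ 2 * ENNReal.ofReal (Real.exp (-Real.pi * u ^ 2))
        = ∫⁻ u, ENNReal.ofReal (‖stepFT E (r * u)‖ ^ 2 * Real.exp (-Real.pi * u ^ 2)) := by
          refine lintegral_congr fun u => ?_
          rw [ENNReal.ofReal_mul (by positivity), ENNReal.ofReal_pow (norm_nonneg _),
            ofReal_norm]
      _ = ‖∫ u, ‖stepFT E (r * u)‖ ^ 2 * Real.exp (-Real.pi * u ^ 2)‖ₑ := by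
          rw [← ofReal_integral_eq_lintegral_ofReal hint1
            (ae_of_all _ fun u => by positivity), Real.enorm_of_nonneg
            (integral_nonneg fun u => by positivity)]
      _ = ‖∫ z : ℝ × ℝ, ((E z.1 : ℂ) * (E z.2 : ℂ))
            * ((Real.exp (-Real.pi * (r * (z.1 - z.2)) ^ 2) : ℝ) : ℂ)‖ₑ := by
          rw [← integral_sq_norm_stepFT_mul_gauss hEint]
          simp_rw [hgauss, ← Complex.ofReal_mul]
          rw [integral_complex_ofReal, ← ofReal_norm, ← ofReal_norm, Complex.norm_real]
      _ ≤ ∫⁻ z : ℝ × ℝ, ENNReal.ofReal (E z.1) * (ENNReal.ofReal M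
            * ENNReal.ofReal (Real.exp (-Real.pi * (r * (z.1 - z.2)) ^ 2))) := by
          refine (enorm_integral_le_lintegral_enorm _).trans (lintegral_mono fun z => ?_)
          rw [← Complex.ofReal_mul, ← Complex.ofReal_mul, ← ofReal_norm, Complex.norm_real,
            Real.norm_of_nonneg (mul_nonneg (mul_nonneg (hE _) (hE _)) (Real.exp_nonneg _)),
            ← ENNReal.ofReal_mul hM0, ← ENNReal.ofReal_mul (hE _), mul_assoc]
          refine ENNReal.ofReal_le_ofReal ?_
          exact mul_le_mul_of_nonneg_left
            (mul_le_mul_of_nonneg_right (hM _) (Real.exp_nonneg _)) (hE _)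
      _ = ENNReal.ofReal M * ENNReal.ofReal r⁻¹ := by
          rw [Measure.volume_eq_prod, lintegral_prod _ (Measurable.aemeasurable (by fun_prop))]
          have h : ∀ x : ℝ, ∫⁻ y : ℝ, ENNReal.ofReal (E x) * (ENNReal.ofReal M
              * ENNReal.ofReal (Real.exp (-Real.pi * (r * (x - y)) ^ 2)))
              = ENNReal.ofReal (E x) * (ENNReal.ofReal M * ENNReal.ofReal r⁻¹) := fun x => by
            rw [lintegral_const_mul _ (by fun_prop), lintegral_const_mul _ (by fun_prop),
              lintegral_ofReal_gauss_scaled hr]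
          simp_rw [h]
          rw [lintegral_mul_const _ (by fun_prop), hmass, one_mul]
  have hchange := lintegral_comp_mul_left_real
    (fun u => ‖stepFT E (r * u)‖ₑ ^ 2 * ENNReal.ofReal (Real.exp (-Real.pi * u ^ 2)))
    (inv_ne_zero hr.ne')
  simp only [mul_inv_cancel_left₀ hr.ne', inv_inv, abs_of_pos hr] at hchange
  rw [hchange]
  calc _ ≤ ENNReal.ofReal r * (ENNReal.ofReal M * ENNReal.ofReal r⁻¹) := by gcongr
    _ = ENNReal.ofReal M := by
        rw [mul_left_comm, ← ENNReal.ofReal_mul hr.le, mul_inv_cancel₀ hr.ne', ENNReal.ofReal_one,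
          mul_one]

lemma lintegral_enorm_stepFT_sq_le {E : ℝ → ℝ} (hE : ∀ x, 0 ≤ E x) (hc : Continuous E)
    (hEint : Integrable E) (hmass : ∫⁻ x, ENNReal.ofReal (E x) = 1) {M : ℝ} (hM : ∀ x, E x ≤ M) :
    ∫⁻ u, ‖stepFT E u‖ₑ ^ 2 ≤ ENNReal.ofReal M := by
  have hψ : Measurable (stepFT E) := (continuous_stepFT hEint).measurable
  have hlim : ∀ u : ℝ, Tendsto (fun j : ℕ =>
      ENNReal.ofReal (Real.exp (-Real.pi * (((j : ℝ) + 1)⁻¹ * u) ^ 2))) atTop (𝓝 1) := fun u => by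
    have h0 : Tendsto (fun j : ℕ => ((j : ℝ) + 1)⁻¹) atTop (𝓝 0) := by
      simpa using tendsto_one_div_add_atTop_nhds_zero_nat (𝕜 := ℝ)
    have hcont : Continuous fun s : ℝ =>
      ENNReal.ofReal (Real.exp (-Real.pi * (s * u) ^ 2)) :=
      ENNReal.continuous_ofReal.comp (by fun_prop)
    simpa [Function.comp_def] using (hcont.tendsto 0).comp h0
  calc ∫⁻ u, ‖stepFT E u‖ₑ ^ 2
      = ∫⁻ u, liminf (fun j : ℕ => ‖stepFT E u‖ₑ ^ 2
          * ENNReal.ofReal (Real.exp (-Real.pi * (((j : ℝ) + 1)⁻¹ * u) ^ 2))) atTop := by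
        refine lintegral_congr fun u => ?_
        rw [ENNReal.liminf_const_mul_of_ne_top (by finiteness), (hlim u).liminf_eq, mul_one]
    _ ≤ liminf (fun j : ℕ => ∫⁻ u, ‖stepFT E u‖ₑ ^ 2
          * ENNReal.ofReal (Real.exp (-Real.pi * (((j : ℝ) + 1)⁻¹ * u) ^ 2))) atTop :=
        lintegral_liminf_le fun j => by fun_prop
    _ ≤ ENNReal.ofReal M := liminf_le_of_le (by isBoundedDefault) fun b hb => by
        obtain ⟨j, hj⟩ := hb.exists
        exact hj.trans (lintegral_enorm_stepFT_sq_mul_gauss_le hE hc hEint hmass hM (by positivity))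

lemma norm_stepFT_le_one {E : ℝ → ℝ} (hE : ∀ x, 0 ≤ E x) (hmass : ∫ x, E x = 1) (u : ℝ) :
    ‖stepFT E u‖ ≤ 1 := by
  rw [← hmass]
  refine (norm_integral_le_integral_norm _).trans_eq ?_
  simp_rw [norm_mul, Circle.norm_coe, one_mul, Complex.norm_real]
  exact integral_congr_ae (ae_of_all _ fun x => Real.norm_of_nonneg (hE x))

lemma abs_sin_le_mul_one_sub_min (z : ℝ) : |Real.sin z| ≤ |z| * (1 - min 1 (z ^ 2) / 20) := by
  wlog hz : 0 ≤ z generalizing z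
  · simpa using this (-z) (by linarith)
  rw [abs_of_nonneg hz]
  rcases le_total z 1 with h1 | h1
  · have hb := abs_le.1 (Real.sin_bound (x := z) (by rwa [abs_of_nonneg hz]))
    rw [abs_of_nonneg (Real.sin_nonneg_of_nonneg_of_le_pi hz (by linarith [Real.pi_gt_three])),
      min_eq_right (by nlinarith)]
    rw [abs_of_nonneg hz] at hb
    have h3 : 0 ≤ z ^ 3 := by positivity
    have h5 : z ^ 5 ≤ z ^ 3 := pow_le_pow_of_le_one hz h1 (by norm_num)
    nlinarith [hb.2]
  · rw [min_eq_left (by nlinarith)]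
    rcases le_total z 2 with h2 | h2
    · rw [abs_of_nonneg (Real.sin_nonneg_of_nonneg_of_le_pi hz (by linarith [Real.pi_gt_three]))]
      have hb := abs_le.1 (Real.sin_bound (x := 1) (by simp))
      have hL := Real.lipschitzWith_sin.dist_le_mul z 1
      rw [Real.dist_eq, Real.dist_eq, abs_of_nonneg (show 0 ≤ z - 1 by linarith)] at hL
      have := (le_abs_self _).trans hL
      norm_num at hb this
      linarith [hb.2]
    · linarith [Real.abs_sin_le_one z]

lemma norm_integral_fourierChar_symm_le {r u : ℝ} (hr : 0 < r) (hu : u ≠ 0) :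
    ‖∫ x in (-r)..r, (Real.fourierChar (-(x * u)) : ℂ)‖
      ≤ 2 * r * (1 - min 1 ((2 * Real.pi * r * u) ^ 2) / 20) := by
  have hc : (-(2 * Real.pi * u * Complex.I) : ℂ) ≠ 0 := by
    simp [hu, Real.pi_ne_zero]
  have hfun : ∀ x : ℝ, (Real.fourierChar (-(x * u)) : ℂ)
      = Complex.exp (-(2 * Real.pi * u * Complex.I) * x) := fun x => by
    rw [Real.fourierChar_apply]
    push_cast
    ring_nf
  simp_rw [hfun]
  rw [integral_exp_mul_complex hc]
  have hnum : Complex.exp (-(2 * Real.pi * u * Complex.I) * (r : ℝ))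
      - Complex.exp (-(2 * Real.pi * u * Complex.I) * ((-r : ℝ) : ℂ))
      = -(2 * Complex.I) * ((Real.sin (2 * Real.pi * r * u) : ℝ) : ℂ) := by
    rw [Complex.ofReal_sin, Complex.sin]
    push_cast
    have hI := Complex.I_sq
    ring_nf
    rw [hI]
    ring
  rw [hnum, norm_div, norm_mul, norm_neg, norm_neg, Complex.norm_real, norm_mul, norm_mul, norm_mul,
    norm_mul, Complex.norm_I, Complex.norm_real, Complex.norm_real, Complex.norm_ofNat,
    Real.norm_eq_abs, Real.norm_eq_abs, Real.norm_eq_abs, abs_of_pos Real.pi_pos, mul_one, mul_one,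
    div_le_iff₀ (by positivity)]
  have hz := abs_sin_le_mul_one_sub_min (2 * Real.pi * r * u)
  rw [abs_mul, abs_of_pos (show 0 < 2 * Real.pi * r by positivity)] at hz
  linarith

lemma exists_norm_stepFT_le_exp {E : ℝ → ℝ} (hE : ∀ x, 0 ≤ E x) (hc : Continuous E)
    (hpos : 0 < E 0) (hEint : Integrable E) (hmass : ∫ x, E x = 1) :
    ∃ κ : ℝ, 0 < κ ∧ ∀ u, ‖stepFT E u‖ ≤ Real.exp (-(κ * min 1 (u ^ 2))) := by
  obtain ⟨r, hr, hEr⟩ : ∃ r > 0, ∀ x ∈ Icc (-r) r, E 0 / 2 ≤ E x := by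
    have hnear : ∀ᶠ x in 𝓝 (0 : ℝ), E 0 / 2 < E x :=
      hc.continuousAt.eventually_const_lt (by linarith)
    obtain ⟨r, hr, hball⟩ := Metric.eventually_nhds_iff.1 hnear
    refine ⟨r / 2, by positivity, fun x hx => (hball ?_).le⟩
    rw [dist_zero_right, Real.norm_eq_abs, abs_lt]
    constructor <;> linarith [hx.1, hx.2]
  set e₀ := E 0 / 2 with he₀
  have he₀pos : 0 < e₀ := by positivity
  have hle1 := norm_stepFT_le_one hE hmass
  refine ⟨r * e₀ / 10 * min 1 ((2 * Real.pi * r) ^ 2), by positivity, fun u => ?_⟩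
  rcases eq_or_ne u 0 with rfl | hu
  · simpa using hle1 0
  have hmin : min 1 ((2 * Real.pi * r) ^ 2) * min 1 (u ^ 2)
      ≤ min 1 ((2 * Real.pi * r * u) ^ 2) := by
    refine le_min ?_ ?_
    · exact mul_le_one₀ (min_le_left _ _) (by positivity) (min_le_left _ _)
    · rw [mul_pow (2 * Real.pi * r)]
      exact mul_le_mul (min_le_right _ _) (min_le_right _ _) (by positivity) (by positivity)
  set box : ℝ → ℝ := (Ioc (-r) r).indicator fun _ => e₀ with hbox
  have hboxint : Integrable box :=
    (integrable_indicator_iff measurableSet_Ioc).2 (integrableOn_const (by simp))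
  have hboxle : ∀ x, box x ≤ E x := fun x =>
    indicator_apply_le' (fun hx => hEr x (Ioc_subset_Icc_self hx)) fun _ => hE x
  have hboxmass : ∫ x, box x = 2 * r * e₀ := by
    rw [hbox, integral_indicator measurableSet_Ioc, setIntegral_const]
    simp [hr.le]
    left
    ring
  have hchar : ∀ {g : ℝ → ℝ}, Integrable g →
      Integrable fun x => (Real.fourierChar (-(x * u)) : ℂ) * (g x : ℂ) := fun hg => by
    refine hg.ofReal.bdd_mul (c := 1) (Continuous.aestronglyMeasurable (by fun_prop))
      (ae_of_all _ fun x => (Circle.norm_coe _).le)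
  have hsplit : stepFT E u = stepFT (fun x => E x - box x) u + stepFT box u := by
    unfold stepFT
    refine Eq.trans ?_ (integral_add (hchar (g := fun x => E x - box x) (hEint.sub hboxint))
      (hchar hboxint))
    congr 1
    ext x
    push_cast
    ring
  have hrest : ‖stepFT (fun x => E x - box x) u‖ ≤ 1 - 2 * r * e₀ := by
    rw [← hmass, ← hboxmass, ← integral_sub hEint hboxint]
    refine (norm_integral_le_integral_norm _).trans_eq ?_
    simp_rw [norm_mul, Circle.norm_coe, one_mul, Complex.norm_real]
    exact integral_congr_ae (ae_of_all _ fun x => Real.norm_of_nonneg (sub_nonneg.2 (hboxle x)))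
  have hboxft : stepFT box u = (∫ x in (-r)..r, (Real.fourierChar (-(x * u)) : ℂ)) * (e₀ : ℂ) := by
    rw [intervalIntegral.integral_of_le (by linarith), ← integral_mul_const,
      ← integral_indicator measurableSet_Ioc]
    unfold stepFT
    congr 1
    ext x
    by_cases hx : x ∈ Ioc (-r) r <;> simp [hbox, hx]
  have hbound := norm_integral_fourierChar_symm_le (u := u) hr hu
  have hboxnorm : ‖stepFT box u‖
      ≤ 2 * r * (1 - min 1 ((2 * Real.pi * r * u) ^ 2) / 20) * e₀ := by
    rw [hboxft, norm_mul, Complex.norm_real, Real.norm_of_nonneg he₀pos.le]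
    gcongr
  have hfinal : ‖stepFT E u‖
      ≤ 1 - r * e₀ / 10 * (min 1 ((2 * Real.pi * r) ^ 2) * min 1 (u ^ 2)) := by
    rw [hsplit]
    refine (norm_add_le _ _).trans ?_
    have := mul_le_mul_of_nonneg_left hmin (show 0 ≤ r * e₀ / 10 by positivity)
    linarith
  refine hfinal.trans ?_
  rw [← mul_assoc]
  exact Real.one_sub_le_exp_neg _

lemma lintegral_enorm_stepFT_pow_le {E : ℝ → ℝ} (hE : ∀ x, 0 ≤ E x) (hc : Continuous E)
    (hEint : Integrable E) (hmass : ∫ x, E x = 1) {M : ℝ} (hM : ∀ x, E x ≤ M) {κ : ℝ} (hκ : 0 < κ)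
    (hψ : ∀ u, ‖stepFT E u‖ ≤ Real.exp (-(κ * min 1 (u ^ 2)))) {k : ℕ} (hk : 0 < k) :
    ∫⁻ u, ‖stepFT E u‖ₑ ^ (k + 2) ≤ ENNReal.ofReal ((√Real.pi + M) / √(κ * k)) := by
  have hM0 : 0 ≤ M := (hE 0).trans (hM 0)
  have hκk : 0 < κ * k := by positivity
  have hexp : Real.exp (-(κ * k)) ≤ (√(κ * k))⁻¹ := by
    rw [Real.exp_neg]
    refine inv_anti₀ (by positivity) ?_
    nlinarith [Real.add_one_le_exp (κ * k), Real.sq_sqrt hκk.le, sq_nonneg (√(κ * k) - 1)]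
  have hgauss : ∫⁻ u : ℝ, ENNReal.ofReal (Real.exp (-(κ * k) * u ^ 2))
      = ENNReal.ofReal (√Real.pi / √(κ * k)) := by
    rw [← ofReal_integral_eq_lintegral_ofReal (integrable_exp_neg_mul_sq hκk)
      (ae_of_all _ fun u => Real.exp_nonneg _), integral_gaussian, Real.sqrt_div Real.pi_pos.le]
  have hpoint : ∀ u, ‖stepFT E u‖ₑ ^ (k + 2) ≤ ENNReal.ofReal (Real.exp (-(κ * k) * u ^ 2))
      + ‖stepFT E u‖ₑ ^ 2 * ENNReal.ofReal ((√(κ * k))⁻¹) := fun u => by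
    have hpow : ‖stepFT E u‖ ^ k ≤ Real.exp (-(κ * k) * min 1 (u ^ 2)) := by
      refine (pow_le_pow_left₀ (norm_nonneg _) (hψ u) k).trans_eq ?_
      rw [← Real.exp_nat_mul]
      ring_nf
    rw [← ofReal_norm, ← ENNReal.ofReal_pow (norm_nonneg _), ← ENNReal.ofReal_pow (norm_nonneg _),
      ← ENNReal.ofReal_mul (by positivity), ← ENNReal.ofReal_add (by positivity) (by positivity)]
    refine ENNReal.ofReal_le_ofReal ?_
    rw [pow_add, mul_comm]
    rcases le_total (u ^ 2) 1 with h | h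
    · rw [min_eq_right h] at hpow
      refine le_add_of_le_of_nonneg ?_ (by positivity)
      exact (mul_le_of_le_one_left (by positivity) (pow_le_one₀ (norm_nonneg _)
        (norm_stepFT_le_one hE hmass u))).trans hpow
    · rw [min_eq_left h, mul_one] at hpow
      refine le_add_of_nonneg_of_le (by positivity) ?_
      gcongr
      exact hpow.trans hexp
  calc ∫⁻ u, ‖stepFT E u‖ₑ ^ (k + 2)
      ≤ ∫⁻ u, (ENNReal.ofReal (Real.exp (-(κ * k) * u ^ 2))
        + ‖stepFT E u‖ₑ ^ 2 * ENNReal.ofReal ((√(κ * k))⁻¹)) := lintegral_mono hpoint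
    _ ≤ ENNReal.ofReal (√Real.pi / √(κ * k))
        + ENNReal.ofReal M * ENNReal.ofReal ((√(κ * k))⁻¹) := by
        rw [lintegral_add_left (by fun_prop), hgauss,
          lintegral_mul_const' _ _ ENNReal.ofReal_ne_top]
        gcongr
        exact lintegral_enorm_stepFT_sq_le hE hc hEint (lintegral_ofReal_eq_one hE hEint hmass) hM
    _ = ENNReal.ofReal ((√Real.pi + M) / √(κ * k)) := by
        rw [← ENNReal.ofReal_mul hM0, ← ENNReal.ofReal_add (by positivity) (by positivity)]
        ring_nf

lemma lintegral_mul_shift_pair {g : ℝ → ℝ≥0∞} (hg : Measurable g) (k : ℝ) {q : ℝ} (hq : 0 < q) :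
    ∫⁻ w : ℝ × ℝ, g (w.2 + k * w.1) * g (w.2 + (k + q) * w.1)
      = ENNReal.ofReal q⁻¹ * (∫⁻ u, g u) ^ 2 := by
  rw [Measure.volume_eq_prod, lintegral_prod _ (Measurable.aemeasurable (by fun_prop))]
  have hshift : ∀ t : ℝ, ∫⁻ s, g (s + k * t) * g (s + (k + q) * t)
      = ∫⁻ s, g s * g (s + q * t) := fun t => by
    rw [← lintegral_add_right_eq_self (fun s => g s * g (s + q * t)) (k * t)]
    refine lintegral_congr fun s => ?_
    ring_nf
  simp_rw [hshift]
  rw [lintegral_lintegral_swap (Measurable.aemeasurable (by fun_prop))]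
  have hinner : ∀ s : ℝ, ∫⁻ t, g s * g (s + q * t)
      = g s * (ENNReal.ofReal q⁻¹ * ∫⁻ u, g u) := fun s => by
    rw [lintegral_const_mul _ (by fun_prop),
      lintegral_comp_mul_left_real (fun v => g (s + v)) hq.ne',
      lintegral_add_left_eq_self, abs_of_pos (by positivity)]
  simp_rw [hinner]
  rw [lintegral_mul_const _ hg]
  ring

/-- Hölder's inequality along an arithmetic progression of lines. -/
lemma lintegral_prod_shift_le {g : ℝ → ℝ≥0∞} (hg : Measurable g) (hg1 : ∀ u, g u ≤ 1) {n q : ℕ}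
    (hq : 0 < q) (hqn : 2 * q ≤ n) :
    ∫⁻ w : ℝ × ℝ, ∏ k ∈ Finset.range n, g (w.2 + k * w.1)
      ≤ ENNReal.ofReal (q : ℝ)⁻¹ * (∫⁻ u, g u ^ q) ^ 2 := by
  have hq0 : (q : ℝ) ≠ 0 := by positivity
  have hpair : ∀ k : ℕ, ∫⁻ w : ℝ × ℝ, (g (w.2 + k * w.1) * g (w.2 + (k + q : ℝ) * w.1)) ^ q
      = ENNReal.ofReal (q : ℝ)⁻¹ * (∫⁻ u, g u ^ q) ^ 2 := fun k => by
    simp_rw [mul_pow]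
    exact lintegral_mul_shift_pair (g := fun u => g u ^ q) (by fun_prop) k (by positivity)
  calc ∫⁻ w : ℝ × ℝ, ∏ k ∈ Finset.range n, g (w.2 + k * w.1)
      ≤ ∫⁻ w : ℝ × ℝ, ∏ k ∈ Finset.range q,
          ((g (w.2 + k * w.1) * g (w.2 + (k + q : ℝ) * w.1)) ^ q) ^ (q : ℝ)⁻¹ := by
        refine lintegral_mono fun w => ?_
        refine (Finset.prod_le_prod_of_subset_of_le_one' (Finset.range_subset_range.2 hqn)
          fun k _ _ => hg1 _).trans_eq ?_
        rw [two_mul, Finset.prod_range_add, ← Finset.prod_mul_distrib]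
        refine Finset.prod_congr rfl fun k _ => ?_
        rw [← ENNReal.rpow_natCast, ← ENNReal.rpow_mul, mul_inv_cancel₀ hq0, ENNReal.rpow_one]
        push_cast
        rw [add_comm (q : ℝ)]
    _ ≤ ∏ k ∈ Finset.range q, (∫⁻ w : ℝ × ℝ,
          (g (w.2 + k * w.1) * g (w.2 + (k + q : ℝ) * w.1)) ^ q) ^ (q : ℝ)⁻¹ :=
        ENNReal.lintegral_prod_norm_pow_le (Finset.range q)
          (fun k _ => Measurable.aemeasurable (by fun_prop)) (by simp [hq0])
          fun _ _ => by positivity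
    _ = ENNReal.ofReal (q : ℝ)⁻¹ * (∫⁻ u, g u ^ q) ^ 2 := by
        simp_rw [hpair]
        rw [Finset.prod_const, Finset.card_range, ← ENNReal.rpow_natCast, ← ENNReal.rpow_mul,
          inv_mul_cancel₀ hq0, ENNReal.rpow_one]

lemma exists_chainKer_le_inv_sq {E : ℝ → ℝ} (hE : ∀ x, 0 ≤ E x) (hc : Continuous E)
    (hpos : 0 < E 0) (hEint : Integrable E) (hmass : ∫ x, E x = 1) {M : ℝ} (hM : ∀ x, E x ≤ M) :
    ∃ C : ℝ, 0 ≤ C ∧ ∀ (m : ℕ) (a b c d : ℝ),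
      chainKer (fun t => ENNReal.ofReal (E t)) m a b c d
        ≤ ENNReal.ofReal (C / ((m : ℝ) + 2) ^ 2) := by
  have hmass' := lintegral_ofReal_eq_one hE hEint hmass
  obtain ⟨κ, hκ, hψ⟩ := exists_norm_stepFT_le_exp hE hc hpos hEint hmass
  refine ⟨36 * M ^ 2 + 36 * (√Real.pi + M) ^ 2 / κ, by positivity, fun m a b c d => ?_⟩
  rcases lt_or_ge m 4 with hm | hm
  · refine (chainKer_le (M := ENNReal.ofReal M) (by fun_prop) hmass'
      (fun x => ENNReal.ofReal_le_ofReal (hM x)) m a b c d).trans ?_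
    rw [← ENNReal.ofReal_pow ((hE 0).trans (hM 0))]
    refine ENNReal.ofReal_le_ofReal ?_
    rw [le_div_iff₀ (by positivity)]
    have hm6 : ((m : ℝ) + 2) ≤ 6 := by
      have : (m : ℝ) ≤ 4 := by exact_mod_cast hm.le
      linarith
    have : ((m : ℝ) + 2) ^ 2 ≤ 36 := by nlinarith [(Nat.cast_nonneg m : (0 : ℝ) ≤ m)]
    have : 0 ≤ 36 * (√Real.pi + M) ^ 2 / κ := by positivity
    nlinarith [sq_nonneg M]
  · obtain ⟨k, hk⟩ : ∃ k, (m + 2) / 2 = k + 2 := ⟨(m + 2) / 2 - 2, by omega⟩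
    have hk0 : 0 < k := by omega
    have hkm : (m : ℝ) + 2 ≤ 2 * k + 5 := by
      have : m + 2 ≤ 2 * k + 5 := by omega
      exact_mod_cast this
    have hk1 : (1 : ℝ) ≤ k := by exact_mod_cast hk0
    refine (chainKer_le_lintegral_prod_stepFT hE hc hmass' hM m a b c d).trans ?_
    refine (lintegral_prod_shift_le (g := fun u => ‖stepFT E u‖ₑ) (q := k + 2)
      (continuous_stepFT hEint).measurable.enorm (fun u => (ofReal_norm _).symm.trans_le
        (ENNReal.ofReal_le_one.2 (norm_stepFT_le_one hE hmass u))) (by omega) (by omega)).trans ?_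
    calc ENNReal.ofReal ((k + 2 : ℕ) : ℝ)⁻¹ * (∫⁻ u, ‖stepFT E u‖ₑ ^ (k + 2)) ^ 2
        ≤ ENNReal.ofReal ((k + 2 : ℕ) : ℝ)⁻¹
          * ENNReal.ofReal ((√Real.pi + M) / √(κ * k)) ^ 2 := by
          gcongr
          exact lintegral_enorm_stepFT_pow_le hE hc hEint hmass hM hκ hψ hk0
      _ ≤ _ := by
          have hM0 : 0 ≤ M := (hE 0).trans (hM 0)
          rw [← ENNReal.ofReal_pow (by positivity), ← ENNReal.ofReal_mul (by positivity)]
          refine ENNReal.ofReal_le_ofReal ?_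
          rw [div_pow, Real.sq_sqrt (by positivity)]
          have hkey : ((m : ℝ) + 2) ^ 2 ≤ 36 * (((k + 2 : ℕ) : ℝ) * k) := by
            push_cast
            nlinarith [(Nat.cast_nonneg m : (0 : ℝ) ≤ m)]
          calc (((k + 2 : ℕ) : ℝ))⁻¹ * ((√Real.pi + M) ^ 2 / (κ * k))
              = (36 * (√Real.pi + M) ^ 2 / κ) / (36 * (((k + 2 : ℕ) : ℝ) * k)) := by
                field_simp
            _ ≤ (36 * (√Real.pi + M) ^ 2 / κ) / ((m : ℝ) + 2) ^ 2 := by gcongr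
            _ ≤ _ := by
                gcongr
                exact le_add_of_nonneg_left (by positivity)

lemma tsum_sq_le_tsum_mul_tsum (a : ℕ → ℝ≥0∞) {s : ℕ → ℝ} (hs : ∀ m, 0 < s m) :
    (∑' m, a m) ^ 2
      ≤ (∑' m, ENNReal.ofReal (s m)⁻¹ ^ 2) * ∑' m, (ENNReal.ofReal (s m) * a m) ^ 2 := by
  have h := ENNReal.lintegral_mul_le_Lp_mul_Lq (Measure.count : Measure ℕ)
    Real.HolderConjugate.two_two
    (f := fun m => ENNReal.ofReal (s m)⁻¹) (g := fun m => ENNReal.ofReal (s m) * a m)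
    Measurable.of_discrete.aemeasurable Measurable.of_discrete.aemeasurable
  have hmul : ∀ m, ENNReal.ofReal (s m)⁻¹ * (ENNReal.ofReal (s m) * a m) = a m := fun m => by
    rw [← mul_assoc, ← ENNReal.ofReal_mul (inv_nonneg.2 (hs m).le), inv_mul_cancel₀ (hs m).ne',
      ENNReal.ofReal_one, one_mul]
  simp only [lintegral_count, Pi.mul_apply, hmul, ENNReal.rpow_two] at h
  refine (pow_le_pow_left₀ zero_le h 2).trans_eq ?_
  rw [mul_pow, ← ENNReal.rpow_two, ← ENNReal.rpow_two, ← ENNReal.rpow_mul, ← ENNReal.rpow_mul]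
  norm_num

lemma lintegral_tsum_sq_lt_top {α : Type*} [MeasurableSpace α] {ν : Measure α}
    {K : ℕ → α → ℝ≥0∞} (hK : ∀ m, Measurable (K m)) {C D : ℝ} (hC : 0 ≤ C)
    (hsup : ∀ m z, K m z ≤ ENNReal.ofReal (C / ((m : ℝ) + 2) ^ 2))
    (hmass : ∀ m, ∫⁻ z, K m z ∂ν ≤ ENNReal.ofReal (D / ((m : ℝ) + 2))) :
    ∫⁻ z, (∑' m, K m z) ^ 2 ∂ν < ⊤ := by
  set s : ℕ → ℝ := fun m => ((m : ℝ) + 2) ^ (3 / 4 : ℝ) with hs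
  have hspos : ∀ m, 0 < s m := fun m => by positivity
  have hssq : ∀ m, s m ^ 2 = ((m : ℝ) + 2) ^ (3 / 2 : ℝ) := fun m => by
    rw [hs, ← Real.rpow_natCast, ← Real.rpow_mul (by positivity)]
    norm_num
  have hsum : Summable fun m : ℕ => (((m : ℝ) + 2) ^ (3 / 2 : ℝ))⁻¹ := by
    have h := (summable_nat_add_iff 2).2 (Real.summable_nat_rpow_inv.2
      (show (1 : ℝ) < 3 / 2 by norm_num))
    simpa using h
  have hweight : ∑' m, ENNReal.ofReal (s m)⁻¹ ^ 2 < ⊤ := by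
    have h : ∀ m, ENNReal.ofReal (s m)⁻¹ ^ 2
        = ENNReal.ofReal (((m : ℝ) + 2) ^ (3 / 2 : ℝ))⁻¹ := fun m => by
      rw [← ENNReal.ofReal_pow (inv_nonneg.2 (hspos m).le), inv_pow, hssq]
    simp_rw [h]
    exact hsum.tsum_ofReal_lt_top
  have hterm : ∀ m, ∫⁻ z, (ENNReal.ofReal (s m) * K m z) ^ 2 ∂ν
      ≤ ENNReal.ofReal (C * D * (((m : ℝ) + 2) ^ (3 / 2 : ℝ))⁻¹) := fun m => by
    calc ∫⁻ z, (ENNReal.ofReal (s m) * K m z) ^ 2 ∂ν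
        ≤ ∫⁻ z, ENNReal.ofReal (s m ^ 2) * ENNReal.ofReal (C / ((m : ℝ) + 2) ^ 2) * K m z ∂ν := by
          refine lintegral_mono fun z => ?_
          rw [mul_pow, ← ENNReal.ofReal_pow (hspos m).le, sq (K m z), ← mul_assoc]
          gcongr
          exact hsup m z
      _ ≤ ENNReal.ofReal (s m ^ 2) * ENNReal.ofReal (C / ((m : ℝ) + 2) ^ 2)
          * ENNReal.ofReal (D / ((m : ℝ) + 2)) := by
          rw [lintegral_const_mul _ (hK m)]
          gcongr
          exact hmass m
      _ = ENNReal.ofReal (C * D * (((m : ℝ) + 2) ^ (3 / 2 : ℝ))⁻¹) := by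
          rw [← ENNReal.ofReal_mul (by positivity), ← ENNReal.ofReal_mul (by positivity)]
          congr 1
          have h3 : ((m : ℝ) + 2) ^ (3 / 2 : ℝ) * ((m : ℝ) + 2) ^ (3 / 2 : ℝ)
              = ((m : ℝ) + 2) ^ 3 := by
            rw [← Real.rpow_add (by positivity)]
            norm_num
          rw [hssq]
          have hp : (((m : ℝ) + 2) ^ (3 / 2 : ℝ)) ≠ 0 := by positivity
          have hm2 : (m : ℝ) + 2 ≠ 0 := by positivity
          rw [← div_eq_mul_inv, eq_div_iff hp]
          field_simp
          linear_combination (C * D) * h3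
  calc ∫⁻ z, (∑' m, K m z) ^ 2 ∂ν
      ≤ ∫⁻ z, (∑' m, ENNReal.ofReal (s m)⁻¹ ^ 2)
          * ∑' m, (ENNReal.ofReal (s m) * K m z) ^ 2 ∂ν :=
        lintegral_mono fun z => tsum_sq_le_tsum_mul_tsum _ hspos
    _ = (∑' m, ENNReal.ofReal (s m)⁻¹ ^ 2)
          * ∑' m, ∫⁻ z, (ENNReal.ofReal (s m) * K m z) ^ 2 ∂ν := by
        rw [lintegral_const_mul' _ _ hweight.ne, lintegral_tsum fun m => by fun_prop]
    _ < ⊤ := ENNReal.mul_lt_top hweight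
        ((ENNReal.tsum_le_tsum hterm).trans_lt (hsum.mul_left _).tsum_ofReal_lt_top)

lemma ofReal_tsum_le (g : ℕ → ℝ) (hg : ∀ n, 0 ≤ g n) :
    ENNReal.ofReal (∑' n, g n) ≤ ∑' n, ENNReal.ofReal (g n) := by
  by_cases h : Summable g
  · exact (ENNReal.ofReal_tsum_of_nonneg hg h).le
  · simp [tsum_eq_zero_of_not_summable h]

lemma ofReal_bker_sq_le {f : ℝ → ℝ → ℕ → ℝ} (hf : ∀ x y n, 0 ≤ f x y n) {lam : ℝ} (hlam : 0 ≤ lam)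
    (x : ℝ) {y : ℝ} (hy : y ≠ 0) :
    ENNReal.ofReal (bker f lam x y ^ 2) ≤ (∑' m, ENNReal.ofReal (f x y (m + 2))) ^ 2 := by
  set g : ℕ → ℝ := fun n => if 2 ≤ n then Real.exp (-lam * n) * f x y n else 0 with hg
  have hg0 : ∀ n, 0 ≤ g n := fun n => by
    rw [hg]
    dsimp only
    split_ifs
    exacts [mul_nonneg (Real.exp_nonneg _) (hf _ _ _), le_rfl]
  have hb : bker f lam x y = ∑' n, g n := by
    rw [bker, if_neg hy, zero_add]
    refine tsum_congr fun n => ?_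
    simp only [hg, ne_eq, hy, not_false_eq_true, and_true]
  have hgm : ∀ m, g (m + 2) ≤ f x y (m + 2) := fun m => by
    simp only [hg, le_add_iff_nonneg_left, zero_le, if_true]
    refine mul_le_of_le_one_left (hf _ _ _) (Real.exp_le_one_iff.2 ?_)
    nlinarith [mul_nonneg hlam (Nat.cast_nonneg (m + 2) : (0 : ℝ) ≤ (m + 2 : ℕ))]
  rw [hb, ENNReal.ofReal_pow (tsum_nonneg hg0)]
  refine pow_le_pow_left₀ zero_le ((ofReal_tsum_le g hg0).trans ?_) 2
  rw [← Summable.sum_add_tsum_nat_add' (k := 2) (f := fun n => ENNReal.ofReal (g n))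
    ENNReal.summable, Finset.sum_eq_zero fun n hn => by
      rw [hg, ENNReal.ofReal_eq_zero]
      exact (if_neg (not_le.2 (Finset.mem_range.1 hn))).le, zero_add]
  exact ENNReal.tsum_le_tsum fun m => ENNReal.ofReal_le_ofReal (hgm m)

lemma ofReal_bker_zero_sq_le {f : ℝ → ℝ → ℕ → ℝ} {E : ℝ → ℝ} (hf : ∀ x y n, 0 ≤ f x y n)
    (hf1 : ∀ x, f x 0 1 ≤ E x) {lam : ℝ} (hlam : 0 ≤ lam) (x : ℝ) :
    ENNReal.ofReal (bker f lam x 0 ^ 2) ≤ ENNReal.ofReal (E x) ^ 2 := by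
  have hb : bker f lam x 0 = Real.exp (-lam) * f x 0 1 := by simp [bker]
  have h0 : 0 ≤ Real.exp (-lam) * f x 0 1 := mul_nonneg (Real.exp_nonneg _) (hf _ _ _)
  rw [hb, ENNReal.ofReal_pow h0]
  gcongr
  exact (mul_le_of_le_one_left (hf _ _ _) (Real.exp_le_one_iff.2 (by linarith))).trans (hf1 x)

lemma lintegral_muK (g : ℝ → ℝ≥0∞) : ∫⁻ x, g x ∂muK = g 0 + ∫⁻ x, g x := by
  rw [muK, lintegral_add_measure, lintegral_dirac]

lemma lintegral_bker_sq_lt_top {E : ℝ → ℝ} (hE : ∀ x, 0 ≤ E x) (hc : Continuous E)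
    (hpos : 0 < E 0) (hEint : Integrable E) (hmass : ∫ x, E x = 1) {M : ℝ} (hM : ∀ x, E x ≤ M)
    {f : ℝ → ℝ → ℕ → ℝ} (hf : ∀ x y n, 0 ≤ f x y n) (hf1 : ∀ x, f x 0 1 ≤ E x)
    (hfK : ∀ x y, y ≠ 0 → ∀ m, ENNReal.ofReal (f x y (m + 2))
      ≤ chainKer (fun t => ENNReal.ofReal (E t)) m x 0 y 0) {lam : ℝ} (hlam : 0 ≤ lam) :
    ∫⁻ x, ∫⁻ y, ENNReal.ofReal (bker f lam x y ^ 2) ∂muK ∂muK < ⊤ := by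
  have hM0 : 0 ≤ M := (hE 0).trans (hM 0)
  set e : ℝ → ℝ≥0∞ := fun t => ENNReal.ofReal (E t) with he
  have hem : Measurable e := by fun_prop
  have heM : ∀ t, e t ≤ ENNReal.ofReal M := fun t => ENNReal.ofReal_le_ofReal (hM t)
  have he1 : ∫⁻ t, e t = 1 := lintegral_ofReal_eq_one hE hEint hmass
  obtain ⟨C, hC, hCK⟩ := exists_chainKer_le_inv_sq hE hc hpos hEint hmass hM
  set G : ℝ → ℝ → ℝ≥0∞ := fun x y => (∑' m, chainKer e m x 0 y 0) ^ 2 with hG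
  have hGm : Measurable fun z : ℝ × ℝ => G z.1 z.2 := by
    have h : ∀ m, Measurable fun z : ℝ × ℝ => chainKer e m z.1 0 z.2 0 := fun m =>
      Measurable.chainKer hem m (by fun_prop) (by fun_prop) (by fun_prop) (by fun_prop)
    exact (Measurable.tsum h).pow_const 2
  have hGprod : ∫⁻ x, ∫⁻ y, G x y < ⊤ := by
    rw [← lintegral_prod (fun z : ℝ × ℝ => G z.1 z.2) hGm.aemeasurable]
    refine lintegral_tsum_sq_lt_top (K := fun m (z : ℝ × ℝ) => chainKer e m z.1 0 z.2 0)
      (fun m => Measurable.chainKer hem m (by fun_prop) (by fun_prop) (by fun_prop) (by fun_prop))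
      (D := 1) hC (fun m z => hCK m _ _ _ _) fun m => ?_
    rw [lintegral_prod _ (Measurable.chainKer hem m (by fun_prop) (by fun_prop) (by fun_prop)
      (by fun_prop)).aemeasurable, lintegral_chainKer_bridge hem he1 m, one_div]
  have hGzero : ∫⁻ y, G 0 y < ⊤ := by
    refine lintegral_tsum_sq_lt_top (K := fun m (y : ℝ) => chainKer e m 0 0 y 0)
      (fun m => Measurable.chainKer hem m (by fun_prop) (by fun_prop) (by fun_prop) (by fun_prop))
      (D := 2 * M) hC (fun m z => hCK m _ _ _ _) fun m => ?_
    rcases m with _ | m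
    · calc ∫⁻ y, chainKer e 0 0 0 y 0 ≤ ∫⁻ y, e y * ENNReal.ofReal M := by
            refine lintegral_mono fun y => ?_
            simp only [chainKer]
            gcongr
            · simp
            · exact heM _
        _ = ENNReal.ofReal (2 * M / (((0 : ℕ) : ℝ) + 2)) := by
            rw [lintegral_mul_const _ hem, he1]
            simp
    · refine (lintegral_chainKer_zero_le hem he1 heM m).trans ?_
      rw [← ENNReal.ofReal_mul hM0, ← div_eq_mul_inv]
      refine ENNReal.ofReal_le_ofReal ?_
      push_cast
      rw [show (m : ℝ) + 1 + 2 = m + 3 by ring]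
      gcongr
      linarith
  have hrow : ∀ x, ∫⁻ y, ENNReal.ofReal (bker f lam x y ^ 2) ∂muK ≤ e x ^ 2 + ∫⁻ y, G x y :=
    fun x => by
      rw [lintegral_muK]
      refine add_le_add (ofReal_bker_zero_sq_le hf hf1 hlam x) (lintegral_mono_ae ?_)
      filter_upwards [Measure.ae_ne volume (0 : ℝ)] with y hy
      refine (ofReal_bker_sq_le hf hlam x hy).trans ?_
      exact pow_le_pow_left₀ zero_le (ENNReal.tsum_le_tsum (hfK x y hy)) 2
  refine (lintegral_mono hrow).trans_lt ?_
  have hdiag : ∫⁻ x, e x ^ 2 < ⊤ := by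
    refine lt_of_le_of_lt (lintegral_mono fun x => ?_)
      (b := ∫⁻ x, ENNReal.ofReal M * e x) ?_
    · rw [sq]
      gcongr
      exact heM x
    · rw [lintegral_const_mul _ hem, he1, mul_one]
      exact ENNReal.ofReal_lt_top
  rw [lintegral_muK, lintegral_add_left (by fun_prop)]
  have hzero : e 0 ^ 2 < ⊤ := ENNReal.pow_lt_top ENNReal.ofReal_lt_top
  exact ENNReal.add_lt_top.2 ⟨ENNReal.add_lt_top.2 ⟨hzero, hGzero⟩,
    ENNReal.add_lt_top.2 ⟨hdiag, hGprod⟩⟩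

lemma fpin_nonneg {E : ℝ → ℝ} (hE : ∀ x, 0 ≤ E x) (x y : ℝ) (n : ℕ) : 0 ≤ fpin E x y n := by
  unfold fpin
  split_ifs
  exacts [hE x, le_rfl, le_rfl, integral_nonneg fun w => Finset.prod_nonneg fun _ _ => hE _]

lemma fwet_nonneg {E : ℝ → ℝ} (hE : ∀ x, 0 ≤ E x) (x y : ℝ) (n : ℕ) : 0 ≤ fwet E x y n := by
  unfold fwet
  split_ifs
  exacts [hE x, le_rfl, le_rfl, integral_nonneg fun w => Finset.prod_nonneg fun _ _ => hE _, le_rfl]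

/-- **Lemma 4.1**: for every `λ ≥ 0` and `a ∈ {p,w}` the kernel `b^{a,λ}` is square
integrable with respect to `μ ⊗ μ` (hence the associated integral operator on `L²(ℝ, μ)`
is Hilbert–Schmidt, in particular compact). -/
theorem bker_square_integrable
    (E : ℝ → ℝ) (σ : ℝ)
    (hE_nonneg : ∀ x, 0 ≤ E x) (hE_cont : Continuous E)
    (hE_bdd : ∃ M, ∀ x, E x ≤ M) (hE_pos : 0 < E 0)
    (hE_int : Integrable E) (hE_mass : ∫ x, E x = 1)
    (hE_mom1 : Integrable fun x => x * E x) (hE_mean : ∫ x, x * E x = 0)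
    (hE_mom2 : Integrable fun x => x ^ 2 * E x) (hE_var : ∫ x, x ^ 2 * E x = σ ^ 2)
    (hσ : 0 < σ)
 :
    ∀ lam : ℝ, 0 ≤ lam →
      (∫⁻ x, ∫⁻ y, ENNReal.ofReal ((bker (fpin E) lam x y) ^ 2) ∂muK ∂muK) < ⊤ ∧
      (∫⁻ x, ∫⁻ y, ENNReal.ofReal ((bker (fwet E) lam x y) ^ 2) ∂muK ∂muK) < ⊤ := by
  obtain ⟨M, hM⟩ := hE_bdd
  intro lam hlam
  refine ⟨lintegral_bker_sq_lt_top hE_nonneg hE_cont hE_pos hE_int hE_mass hM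
      (fpin_nonneg hE_nonneg) (fun x => by simp [fpin])
      (fun x y hy m => ofReal_fpin_le hE_nonneg hE_cont.measurable x hy m) hlam,
    lintegral_bker_sq_lt_top hE_nonneg hE_cont hE_pos hE_int hE_mass hM
      (fwet_nonneg hE_nonneg) (fun x => ?_)
      (fun x y hy m => ofReal_fwet_le hE_nonneg hE_cont.measurable x hy m) hlam⟩
  by_cases hx : 0 ≤ x <;> simp [fwet, hx, hE_nonneg]
end
end

section
/- Convolution power bound for kernels: let (A(n))_{n∈ℕ} and L be kernels on ℝ and suppose there is c > 0 such that A_{x,F}(n) ≤ c L_{x,F}/n² for every n ∈ ℕ, x ∈ ℝ and Borel set F. Set G_{x,·} := ∑_{n∈ℕ} A_{x,·}(n). Then for every k ≥ 1, n ≥ 1, x ∈ ℝ and Borel set F, A^{*k}_{x,F}(n) ≤ (c k²/n²) ∑_{i=0}^{k−1} (G^{∘i} ∘ L ∘ G^{∘(k−1−i)})_{x,F}. -/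
open MeasureTheory Filter Topology Set
open scoped ENNReal NNReal BigOperators

noncomputable section

/-- composition of kernels: `(A ∘ B)_{x,F} = ∫ B_{z,F} A_{x,dz}` -/
def kcomp (A B : ℝ → Measure ℝ) (x : ℝ) : Measure ℝ := (A x).bind B

/-- `k`-fold composition of a kernel with itself, `A^{∘0}_{x,·} = δ_x` -/
def kpow (A : ℝ → Measure ℝ) : ℕ → ℝ → Measure ℝ
  | 0 => fun x => Measure.dirac x
  | k + 1 => kcomp (kpow A k) A

/-- convolution of families of kernels: `(A * B)_{x,·}(n) = ∑_{m=0}^n (A(m) ∘ B(n-m))_{x,·}` -/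
def kconv (A B : ℕ → ℝ → Measure ℝ) (n : ℕ) (x : ℝ) : Measure ℝ :=
  ∑ m ∈ Finset.range (n + 1), ((A m x).bind (B (n - m)))

/-- `k`-fold convolution of a family of kernels with itself,
`A^{*0}_{x,·}(n) = δ_x 1_{(n = 0)}` -/
def kconvpow (A : ℕ → ℝ → Measure ℝ) : ℕ → ℕ → ℝ → Measure ℝ
  | 0 => fun n x => if n = 0 then Measure.dirac x else 0
  | k + 1 => kconv (kconvpow A k) A

/-- `(1 - A)^{-1}_{x,·} = ∑_{k≥0} A^{∘k}_{x,·}` -/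
def kinv (A : ℝ → Measure ℝ) (x : ℝ) : Measure ℝ := Measure.sum fun k : ℕ => kpow A k x

/-- `G_{x,·} = ∑_{n ∈ ℕ} A_{x,·}(n)` -/
def kG (A : ℕ → ℝ → Measure ℝ) (x : ℝ) : Measure ℝ := Measure.sum fun n : ℕ => A n x

section BindLemmas

variable {α β : Type*} [MeasurableSpace α] [MeasurableSpace β]

theorem bind_mono_measure {μ ν : Measure α} {κ η : α → Measure β} (hμν : μ ≤ ν)
    (hκ : Measurable κ) (hη : Measurable η) (hκη : ∀ x, κ x ≤ η x) :
    μ.bind κ ≤ ν.bind η := by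
  refine Measure.le_iff.2 fun s hs => ?_
  rw [Measure.bind_apply hs hκ.aemeasurable, Measure.bind_apply hs hη.aemeasurable]
  exact lintegral_mono' hμν fun x => hκη x s

theorem finsetSum_bind {ι : Type*} (t : Finset ι) (μ : ι → Measure α) {κ : α → Measure β}
    (hκ : Measurable κ) : (∑ i ∈ t, μ i).bind κ = ∑ i ∈ t, (μ i).bind κ := by
  ext s hs
  simp only [Measure.bind_apply hs hκ.aemeasurable, Measure.finsetSum_apply,
    lintegral_finsetSum_measure]

theorem sum_bind_le_bind_sum (μ : Measure α) {κ : ℕ → α → Measure β}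
    (hκ : ∀ n, Measurable (κ n)) (hsum : Measurable fun x => Measure.sum fun n => κ n x)
    (t : Finset ℕ) :
    ∑ n ∈ t, μ.bind (κ n) ≤ μ.bind fun x => Measure.sum fun n => κ n x := by
  refine Measure.le_iff.2 fun s hs => ?_
  simp only [Measure.finsetSum_apply, Measure.bind_apply hs (hκ _).aemeasurable,
    Measure.bind_apply hs hsum.aemeasurable, Measure.sum_apply _ hs]
  have hmeas : ∀ n, Measurable fun x => κ n x s := fun n =>
    (Measure.measurable_coe hs).comp (hκ n)
  rw [← lintegral_finsetSum _ fun n _ => hmeas n]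
  exact lintegral_mono fun x => ENNReal.sum_le_tsum t

end BindLemmas

theorem measurable_kcomp {A B : ℝ → Measure ℝ} (hA : Measurable A) (hB : Measurable B) :
    Measurable (kcomp A B) :=
  (Measure.measurable_bind' hB).comp hA

theorem measurable_kpow {A : ℝ → Measure ℝ} (hA : Measurable A) (k : ℕ) :
    Measurable (kpow A k) := by
  induction k with
  | zero => exact Measure.measurable_dirac
  | succ k ih => exact measurable_kcomp ih hA

theorem measurable_kG {A : ℕ → ℝ → Measure ℝ} (hA : ∀ n, Measurable (A n)) :
    Measurable (kG A) := by
  refine Measure.measurable_of_measurable_coe _ fun s hs => ?_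
  simp only [kG, Measure.sum_apply _ hs]
  exact Measurable.tsum fun n => (Measure.measurable_coe hs).comp (hA n)

theorem sum_kconvpow_le_kpow_kG {A : ℕ → ℝ → Measure ℝ} (hA : ∀ n, Measurable (A n))
    (k N : ℕ) (x : ℝ) :
    ∑ n ∈ Finset.range N, kconvpow A k n x ≤ kpow (kG A) k x := by
  induction k generalizing N with
  | zero =>
    rw [show kpow (kG A) 0 x = Measure.dirac x from rfl]
    simp only [kconvpow, Finset.sum_ite_eq', Finset.mem_range]
    split_ifs
    · exact le_rfl
    · exact Measure.zero_le _
  | succ k ih =>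
    calc ∑ n ∈ Finset.range N, kconvpow A (k + 1) n x
        = ∑ m ∈ Finset.range N, ∑ j ∈ Finset.range (N - m),
            (kconvpow A k m x).bind (A j) :=
          Finset.sum_range_diag_flip N fun m j => (kconvpow A k m x).bind (A j)
      _ ≤ ∑ m ∈ Finset.range N, (kconvpow A k m x).bind (kG A) :=
          Finset.sum_le_sum fun m _ => sum_bind_le_bind_sum _ hA (measurable_kG hA) _
      _ = (∑ m ∈ Finset.range N, kconvpow A k m x).bind (kG A) :=
          (finsetSum_bind _ _ (measurable_kG hA)).symm
      _ ≤ kpow (kG A) (k + 1) x :=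
          bind_mono_measure (ih N) (measurable_kG hA) (measurable_kG hA) fun _ => le_rfl

/-- The sum `∑_{i<k} G^{∘i} ∘ L ∘ G^{∘(k-1-i)}` over all positions of a single factor `L`. -/
def insertionSum (G L : ℝ → Measure ℝ) (k : ℕ) (x : ℝ) : Measure ℝ :=
  ∑ i ∈ Finset.range k, kcomp (kcomp (kpow G i) L) (kpow G (k - 1 - i)) x

theorem insertionSum_succ {G L : ℝ → Measure ℝ} (hG : Measurable G) (k : ℕ) (x : ℝ) :
    insertionSum G L (k + 1) x = (insertionSum G L k x).bind G + (kpow G k x).bind L := by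
  rw [insertionSum, Finset.sum_range_succ, insertionSum, finsetSum_bind _ _ hG]
  congr 1
  · refine Finset.sum_congr rfl fun i hi => ?_
    have hi' : k + 1 - 1 - i = (k - 1 - i) + 1 := by
      have := Finset.mem_range.1 hi
      omega
    rw [hi']
    exact (Measure.bind_bind (measurable_kpow hG _).aemeasurable hG.aemeasurable).symm
  · rw [show k + 1 - 1 - k = 0 by omega]
    exact Measure.bind_dirac

/-- When `n ≥ k t` is split into `k` parts, one part is at least `t`: the bound `C • L` is used
for that part and all other parts are summed freely. -/
theorem kconvpow_le_smul_insertionSum {A : ℕ → ℝ → Measure ℝ} {L : ℝ → Measure ℝ}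
    (hA : ∀ n, Measurable (A n)) (hL : Measurable L) {t : ℝ} (ht : 0 ≤ t) {C : ℝ≥0∞}
    (hAL : ∀ n : ℕ, t ≤ n → ∀ x, A n x ≤ C • L x)
    (k n : ℕ) (hn : 1 ≤ n) (hkn : k * t ≤ n) (x : ℝ) :
    kconvpow A k n x ≤ C • insertionSum (kG A) L k x := by
  induction k generalizing n with
  | zero =>
    rw [show kconvpow A 0 n x = 0 from if_neg (by omega)]
    exact Measure.zero_le _
  | succ k ih =>
    have hG := measurable_kG hA
    set S := insertionSum (kG A) L k x
    have hCL : Measurable fun z => C • L z :=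
      Measure.measurable_of_measurable_coe _ fun s hs =>
        ((Measure.measurable_coe hs).comp hL).const_mul C
    have hterm : ∀ m ∈ Finset.range (n + 1), (kconvpow A k m x).bind (A (n - m)) ≤
        C • S.bind (A (n - m)) + C • (kconvpow A k m x).bind L := by
      intro m hm
      have hmn : m ≤ n := Nat.lt_succ_iff.1 (Finset.mem_range.1 hm)
      rcases le_or_gt t ((n - m : ℕ) : ℝ) with h | h
      · refine le_trans ?_ (Measure.le_add_left le_rfl)
        refine (bind_mono_measure le_rfl (hA _) hCL (hAL _ h)).trans_eq ?_
        ext s hs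
        simp only [Measure.bind_apply hs hCL.aemeasurable, Measure.smul_apply,
          Measure.bind_apply hs hL.aemeasurable, smul_eq_mul]
        exact lintegral_const_mul _ ((Measure.measurable_coe hs).comp hL)
      · refine le_trans ?_ (Measure.le_add_right le_rfl)
        rw [Nat.cast_sub hmn] at h
        push_cast at hkn
        have hkm : k * t < m := by linarith
        have hm0 : (0 : ℝ) < m := lt_of_le_of_lt (by positivity) hkm
        rw [← Measure.bind_smul]
        exact bind_mono_measure (ih m (by exact_mod_cast hm0) hkm.le) (hA _) (hA _)
          fun _ => le_rfl
    calc kconvpow A (k + 1) n x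
        ≤ ∑ m ∈ Finset.range (n + 1),
            (C • S.bind (A (n - m)) + C • (kconvpow A k m x).bind L) :=
          Finset.sum_le_sum hterm
      _ = C • (∑ j ∈ Finset.range (n + 1), S.bind (A j) +
            (∑ m ∈ Finset.range (n + 1), kconvpow A k m x).bind L) := by
          rw [Finset.sum_add_distrib, ← Finset.smul_sum, ← Finset.smul_sum,
            Finset.sum_flip fun j => S.bind (A j), finsetSum_bind _ _ hL, smul_add]
      _ ≤ C • (S.bind (kG A) + (kpow (kG A) k x).bind L) := by
          refine Measure.le_iff.2 fun s _ => mul_le_mul_right (add_le_add ?_ ?_) C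
          · exact sum_bind_le_bind_sum S hA hG _ s
          · exact bind_mono_measure (sum_kconvpow_le_kpow_kG hA k _ x) hL hL
              (fun _ => le_rfl) s
      _ = C • insertionSum (kG A) L (k + 1) x := by rw [insertionSum_succ hG]

/-- Equation (7.10): convolution power bound for kernels: if `A_{x,F}(n) ≤ c L_{x,F}/n²`,
then `A^{*k}_{x,F}(n) ≤ (c k²/n²) ∑_{i=0}^{k-1} (G^{∘i} ∘ L ∘ G^{∘(k-1-i)})_{x,F}`,
where `G = ∑_{n ∈ ℕ} A(n)`. -/
theorem convolution_power_bound
    (A : ℕ → ℝ → Measure ℝ) (L : ℝ → Measure ℝ)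
    (hA_meas : ∀ n, Measurable (A n)) (hL_meas : Measurable L)
    (hA_zero : ∀ x, A 0 x = 0)
    (c : ℝ) (hc : 0 < c)
    (hbound : ∀ n : ℕ, 1 ≤ n → ∀ x : ℝ, ∀ F : Set ℝ, MeasurableSet F →
      A n x F ≤ ENNReal.ofReal (c / (n : ℝ) ^ 2) * L x F) :
    ∀ k : ℕ, 1 ≤ k → ∀ n : ℕ, 1 ≤ n → ∀ x : ℝ, ∀ F : Set ℝ, MeasurableSet F →
      kconvpow A k n x F ≤ ENNReal.ofReal (c * (k : ℝ) ^ 2 / (n : ℝ) ^ 2) *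
        ∑ i ∈ Finset.range k,
          (kcomp (kcomp (kpow (kG A) i) L) (kpow (kG A) (k - 1 - i))) x F := by
  intro k hk n hn x F _
  have hk' : (0 : ℝ) < k := by exact_mod_cast hk
  have hn' : (0 : ℝ) < n := by exact_mod_cast hn
  have ht : (0 : ℝ) < n / k := by positivity
  have hAL : ∀ m : ℕ, (n / k : ℝ) ≤ m → ∀ z,
      A m z ≤ ENNReal.ofReal (c * (k : ℝ) ^ 2 / (n : ℝ) ^ 2) • L z := by
    intro m hm z
    have hm' : (0 : ℝ) < m := ht.trans_le hm
    refine Measure.le_iff.2 fun s hs => (hbound m (by exact_mod_cast hm') z s hs).trans ?_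
    rw [Measure.smul_apply, smul_eq_mul]
    refine mul_le_mul_left (ENNReal.ofReal_le_ofReal ?_) _
    calc c / (m : ℝ) ^ 2 ≤ c / (n / k : ℝ) ^ 2 := by gcongr
      _ = c * (k : ℝ) ^ 2 / (n : ℝ) ^ 2 := by field_simp
  have h := kconvpow_le_smul_insertionSum hA_meas hL_meas ht.le hAL k n hn
    (mul_div_cancel₀ _ hk'.ne').le x F
  rwa [Measure.smul_apply, insertionSum, Measure.finsetSum_apply, smul_eq_mul] at h
end
end
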